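/- arXiv:1502.03796 — 16 statements merged into one kernel-verified Lean document; each statement's English description precedes it below -/
import Mathlib

section
/- Let I be an arc-consistent binary CSP instance with variable set X and let x ∈ X. Suppose the broken-triangle pattern (BTP) does not occur at x, i.e., there do not exist distinct variables y, z ∈ X∖{x}, values p ∈ D(y), q ∈ D(z) and values c, d ∈ D(x) such that cpt(⟨y,p⟩,⟨z,q⟩)=TRUE, cpt(⟨y,p⟩,⟨x,c⟩)=TRUE, cpt(⟨z,q⟩,⟨x,d⟩)=TRUE, cpt(⟨y,p⟩,⟨x,d⟩)=FALSE and cpt(⟨z,q⟩,⟨x,c⟩)=FALSE. Then whenever I has a partial solution on X∖{x}, I has a solution (that is, variable x can be eliminated). -/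
/-- A binary CSP instance: a set of variables `V`, for each variable a finite
domain, and a symmetric Boolean compatibility function on assignments. -/
structure BinaryCSP (V D : Type) where
  dom : V → Finset D
  cpt : V → D → V → D → Bool
  symm : ∀ v a w b, cpt v a w b = cpt w b v a

namespace BinaryCSP

variable {V D : Type}

/-- A partial solution on a set `Y` of variables. -/
def PartialSol (I : BinaryCSP V D) (Y : Set V) (s : V → D) : Prop :=
  (∀ v ∈ Y, s v ∈ I.dom v) ∧
  ∀ v ∈ Y, ∀ w ∈ Y, v ≠ w → I.cpt v (s v) w (s w) = true

/-- A solution: a partial solution on all the variables. -/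
def Sol (I : BinaryCSP V D) (s : V → D) : Prop :=
  I.PartialSol Set.univ s

/-- Arc consistency. -/
def ArcConsistent (I : BinaryCSP V D) : Prop :=
  ∀ v, ∀ a ∈ I.dom v, ∀ w, w ≠ v → ∃ b ∈ I.dom w, I.cpt v a w b = true

end BinaryCSP

/-- if the broken-triangle pattern (BTP) does not occur at `x` in an
arc-consistent binary CSP instance, then `x` can be eliminated: whenever there is a
partial solution on all variables except `x`, there is a solution. -/
theorem btp_var_elim {V D : Type} [Fintype V] (I : BinaryCSP V D)
    (hne : ∀ v, (I.dom v).Nonempty)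
    (hac : I.ArcConsistent) (x : V)
    (hBTP : ¬ ∃ (y z : V) (p q c d : D),
      y ≠ x ∧ z ≠ x ∧ y ≠ z ∧
      p ∈ I.dom y ∧ q ∈ I.dom z ∧ c ∈ I.dom x ∧ d ∈ I.dom x ∧
      I.cpt y p z q = true ∧ I.cpt y p x c = true ∧ I.cpt z q x d = true ∧
      I.cpt y p x d = false ∧ I.cpt z q x c = false)
    (s : V → D) (hs : I.PartialSol {v | v ≠ x} s) :
    ∃ t, I.Sol t := by
  classical
  obtain ⟨hdom, hcpt⟩ := hs
  let S : V → Finset D := fun v => (I.dom x).filter fun c => I.cpt v (s v) x c = true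
  have hchain : ∀ y z, y ≠ x → z ≠ x → S y ⊆ S z ∨ S z ⊆ S y := by
    intro y z hy hz
    by_contra! h
    obtain ⟨hyz, hzy⟩ := h
    obtain ⟨c, hcy, hcz⟩ := Finset.not_subset.mp hyz
    obtain ⟨d, hdz, hdy⟩ := Finset.not_subset.mp hzy
    have hne_yz : y ≠ z := by
      rintro rfl
      exact hcz hcy
    simp only [S, Finset.mem_filter, not_and, Bool.not_eq_true] at hcy hcz hdz hdy
    exact hBTP ⟨y, z, s y, s z, c, d, hy, hz, hne_yz, hdom y hy, hdom z hz, hcy.1, hdz.1,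
      hcpt y hy z hz hne_yz, hcy.2, hdz.2, hdy hdz.1, hcz hcy.1⟩
  have hcommon : ∃ c ∈ I.dom x, ∀ v, v ≠ x → I.cpt v (s v) x c = true := by
    rcases Set.eq_empty_or_nonempty {v | v ≠ x} with hempty | hnonempty
    · obtain ⟨c, hc⟩ := hne x
      exact ⟨c, hc, fun v hv => (Set.eq_empty_iff_forall_notMem.mp hempty v hv).elim⟩
    · obtain ⟨y, hy, hmin⟩ :=
        Set.exists_min_image {v | v ≠ x} (fun v => (S v).card) (Set.toFinite _) hnonempty
      obtain ⟨c, hc, hyc⟩ := hac y (s y) (hdom y hy) x (Ne.symm hy)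
      have hcS : c ∈ S y := Finset.mem_filter.mpr ⟨hc, hyc⟩
      refine ⟨c, hc, fun v hv => ?_⟩
      have hsub : S y ⊆ S v := (hchain y v hy hv).elim id fun h =>
        (Finset.eq_of_subset_of_card_le h (hmin v hv)).ge
      exact (Finset.mem_filter.mp (hsub hcS)).2
  obtain ⟨c, hc, hcx⟩ := hcommon
  refine ⟨Function.update s x c, fun v _ => ?_, fun v _ w _ hvw => ?_⟩
  · by_cases hv : v = x
    · subst hv
      simpa using hc
    · simpa [hv] using hdom v hv
  · by_cases hv : v = x
    · subst hv
      simpa [hvw.symm, I.symm v c] using hcx w hvw.symm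
    · by_cases hw : w = x
      · subst hw
        simpa [hv] using hcx v hv
      · simpa [hv, hw] using hcpt v hv w hw hvw
end

section
/- Let I be an arc-consistent binary CSP instance with variable set X and let x ∈ X. Suppose there exists a value d ∈ D(x) such that the pattern ∃subBTP does not occur at x with mapping a ↦ d, i.e., there do not exist distinct variables y, z ∈ X∖{x}, values p ∈ D(y), q ∈ D(z) and a value b ∈ D(x) such that cpt(⟨y,p⟩,⟨z,q⟩)=TRUE, cpt(⟨y,p⟩,⟨x,b⟩)=TRUE, cpt(⟨z,q⟩,⟨x,b⟩)=FALSE and cpt(⟨y,p⟩,⟨x,d⟩)=FALSE. Then whenever I has a partial solution on X∖{x}, I has a solution (that is, variable x can be eliminated). -/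
/-- A partial solution on all variables but `x` extends to a solution as soon as some
value for `x` is compatible with all of its assignments. -/
theorem BinaryCSP.PartialSol.exists_sol_of_compatible {V D : Type} {I : BinaryCSP V D} {x : V}
    {s : V → D} (hs : I.PartialSol {v | v ≠ x} s) {b : D} (hb : b ∈ I.dom x)
    (hcpt : ∀ v, v ≠ x → I.cpt v (s v) x b = true) : ∃ t, I.Sol t := by
  classical
  refine ⟨Function.update s x b, fun v _ => ?_, fun v _ w _ hvw => ?_⟩
  · by_cases hv : v = x
    · subst hv; simpa using hb
    · simpa [hv] using hs.1 v hv
  · by_cases hv : v = x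
    · subst hv
      simpa [hvw.symm, I.symm v b] using hcpt w hvw.symm
    · by_cases hw : w = x
      · subst hw
        simpa [hv] using hcpt v hv
      · simpa [hv, hw] using hs.2 v hv w hw hvw

/-- if the pattern ∃subBTP does not occur at `x` (for the mapping
`a ↦ d`) in an arc-consistent binary CSP instance, then `x` can be eliminated. -/
theorem existsSubBTP_var_elim {V D : Type} [Fintype V] (I : BinaryCSP V D)
    (hne : ∀ v, (I.dom v).Nonempty)
    (hac : I.ArcConsistent) (x : V)
    (hpat : ∃ d ∈ I.dom x, ¬ ∃ (y z : V) (p q : D) (b : D),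
      y ≠ x ∧ z ≠ x ∧ y ≠ z ∧
      p ∈ I.dom y ∧ q ∈ I.dom z ∧ b ∈ I.dom x ∧
      I.cpt y p z q = true ∧ I.cpt y p x b = true ∧
      I.cpt z q x b = false ∧ I.cpt y p x d = false)
    (s : V → D) (hs : I.PartialSol {v | v ≠ x} s) :
    ∃ t, I.Sol t := by
  obtain ⟨d, hd, hpat⟩ := hpat
  by_cases hcpt : ∀ v, v ≠ x → I.cpt v (s v) x d = true
  · exact hs.exists_sol_of_compatible hd hcpt
  · push Not at hcpt
    obtain ⟨y, hy, hyd⟩ := hcpt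
    obtain ⟨b, hb, hyb⟩ := hac y (s y) (hs.1 y hy) x hy.symm
    refine hs.exists_sol_of_compatible hb fun z hz => ?_
    by_cases hyz : y = z
    · exact hyz ▸ hyb
    · by_contra hzb
      exact hpat ⟨y, z, s y, s z, b, hy, hz, hyz, hs.1 y hy, hs.1 z hz, hb,
        hs.2 y hy z hz hyz, hyb, by simpa using hzb, by simpa using hyd⟩
end

section
/- Let I be an arc-consistent binary CSP instance with variable set X and let x ∈ X. Suppose there exists a value d ∈ D(x) such that the pattern ∃invsubBTP does not occur at x with mapping a ↦ d, i.e., there do not exist distinct variables y, z ∈ X∖{x}, values s₀, t₀ ∈ D(y) and a value u ∈ D(z) such that cpt(⟨y,s₀⟩,⟨x,d⟩)=FALSE, cpt(⟨y,t₀⟩,⟨x,d⟩)=TRUE, cpt(⟨z,u⟩,⟨x,d⟩)=TRUE and cpt(⟨y,t₀⟩,⟨z,u⟩)=FALSE. Then whenever I has a partial solution on X∖{x}, I has a solution (that is, variable x can be eliminated). -/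
/-- if the pattern ∃invsubBTP does not occur at `x` (for the mapping
`a ↦ d`) in an arc-consistent binary CSP instance, then `x` can be eliminated. -/
theorem existsInvsubBTP_var_elim {V D : Type} [Fintype V] (I : BinaryCSP V D)
    (hne : ∀ v, (I.dom v).Nonempty)
    (hac : I.ArcConsistent) (x : V)
    (hpat : ∃ d ∈ I.dom x, ¬ ∃ (y z : V) (s₀ t₀ : D) (u : D),
      y ≠ x ∧ z ≠ x ∧ y ≠ z ∧
      s₀ ∈ I.dom y ∧ t₀ ∈ I.dom y ∧ u ∈ I.dom z ∧
      I.cpt y s₀ x d = false ∧ I.cpt y t₀ x d = true ∧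
      I.cpt z u x d = true ∧ I.cpt y t₀ z u = false)
    (s : V → D) (hs : I.PartialSol {v | v ≠ x} s) :
    ∃ t, I.Sol t := by
  classical
  obtain ⟨d, hd, hpat⟩ := hpat
  obtain ⟨hdom, hcpt⟩ := hs
  have hsupp : ∀ v, v ≠ x → ∃ b ∈ I.dom v, I.cpt v b x d = true ∧
      (I.cpt v (s v) x d = true → b = s v) := by
    intro v hv
    by_cases hgood : I.cpt v (s v) x d = true
    · exact ⟨s v, hdom v hv, hgood, fun _ => rfl⟩
    · obtain ⟨b, hb, hdb⟩ := hac x d hd v hv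
      exact ⟨b, hb, by rw [I.symm, hdb], fun h => absurd h hgood⟩
  have : Nonempty D := ⟨d⟩
  choose! t htdom htd hts using hsupp
  have hbad : ∀ v, v ≠ x → ∀ w, w ≠ x → v ≠ w → I.cpt v (s v) x d = false →
      I.cpt v (t v) w (t w) = true := by
    intro v hv w hw hvw hb
    by_contra hc
    exact hpat ⟨v, w, s v, t v, t w, hv, hw, hvw, hdom v hv, htdom v hv, htdom w hw,
      hb, htd v hv, htd w hw, Bool.eq_false_of_not_eq_true hc⟩
  have ht : ∀ v, v ≠ x → ∀ w, w ≠ x → v ≠ w → I.cpt v (t v) w (t w) = true := by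
    intro v hv w hw hvw
    rcases Bool.eq_false_or_eq_true (I.cpt v (s v) x d) with h₁ | h₁
    · rcases Bool.eq_false_or_eq_true (I.cpt w (s w) x d) with h₂ | h₂
      · rw [hts v hv h₁, hts w hw h₂]
        exact hcpt v hv w hw hvw
      · rw [I.symm]
        exact hbad w hw v hv hvw.symm h₂
    · exact hbad v hv w hw hvw h₁
  refine ⟨Function.update t x d, fun v _ => ?_, fun v _ w _ hvw => ?_⟩
  · obtain rfl | hv := eq_or_ne v x
    · simpa using hd
    · simpa [hv] using htdom v hv
  · obtain rfl | hv := eq_or_ne v x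
    · rw [I.symm]
      simpa [hvw.symm] using htd w hvw.symm
    · obtain rfl | hw := eq_or_ne w x
      · simpa [hv] using htd v hv
      · simpa [hv, hw] using ht v hv w hw hvw
end

section
/- Let I be an arc-consistent binary CSP instance with variable set X and let x ∈ X. Suppose there exists a value d ∈ D(x) such that the pattern ∃snake does not occur at x with mapping a ↦ d, i.e., there do not exist distinct variables y, z ∈ X∖{x}, values s₀, t₀ ∈ D(y) and a value u ∈ D(z) such that cpt(⟨y,s₀⟩,⟨x,d⟩)=FALSE, cpt(⟨y,t₀⟩,⟨x,d⟩)=TRUE, cpt(⟨y,s₀⟩,⟨z,u⟩)=TRUE and cpt(⟨y,t₀⟩,⟨z,u⟩)=FALSE. Then whenever I has a partial solution on X∖{x}, I has a solution (that is, variable x can be eliminated). -/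
namespace BinaryCSP

variable {V D : Type}

/-- If ∃snake does not occur at `x` with mapping `a ↦ d`, then every value `a` of another variable
`v` is dominated, away from `x`, by a value `b` of `v` that is compatible with `d`. -/
theorem exists_dominating_value (I : BinaryCSP V D) (hac : I.ArcConsistent)
    {x : V} {d : D} (hd : d ∈ I.dom x)
    (hno : ¬ ∃ (y z : V) (s₀ t₀ : D) (u : D),
      y ≠ x ∧ z ≠ x ∧ y ≠ z ∧
      s₀ ∈ I.dom y ∧ t₀ ∈ I.dom y ∧ u ∈ I.dom z ∧
      I.cpt y s₀ x d = false ∧ I.cpt y t₀ x d = true ∧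
      I.cpt y s₀ z u = true ∧ I.cpt y t₀ z u = false)
    {v : V} (hv : v ≠ x) {a : D} (ha : a ∈ I.dom v) :
    ∃ b ∈ I.dom v, I.cpt v b x d = true ∧
      ∀ w, w ≠ x → v ≠ w → ∀ u ∈ I.dom w, I.cpt v a w u = true → I.cpt v b w u = true := by
  by_cases had : I.cpt v a x d = true
  · exact ⟨a, ha, had, fun _ _ _ _ _ h ↦ h⟩
  obtain ⟨b, hb, hdb⟩ := hac x d hd v hv
  have hbd : I.cpt v b x d = true := (I.symm _ _ _ _).trans hdb
  refine ⟨b, hb, hbd, fun w hw hvw u hu hau ↦ ?_⟩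
  by_contra hbu
  exact hno ⟨v, w, a, b, u, hv, hw, hvw, ha, hb, hu,
    Bool.eq_false_iff.mpr had, hbd, hau, Bool.eq_false_iff.mpr hbu⟩

end BinaryCSP

/-- if the pattern ∃snake does not occur at `x` (for the mapping
`a ↦ d`) in an arc-consistent binary CSP instance, then `x` can be eliminated. -/
theorem existsSnake_var_elim {V D : Type} [Fintype V] (I : BinaryCSP V D)
    (hne : ∀ v, (I.dom v).Nonempty)
    (hac : I.ArcConsistent) (x : V)
    (hpat : ∃ d ∈ I.dom x, ¬ ∃ (y z : V) (s₀ t₀ : D) (u : D),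
      y ≠ x ∧ z ≠ x ∧ y ≠ z ∧
      s₀ ∈ I.dom y ∧ t₀ ∈ I.dom y ∧ u ∈ I.dom z ∧
      I.cpt y s₀ x d = false ∧ I.cpt y t₀ x d = true ∧
      I.cpt y s₀ z u = true ∧ I.cpt y t₀ z u = false)
    (s : V → D) (hs : I.PartialSol {v | v ≠ x} s) :
    ∃ t, I.Sol t := by
  classical
  obtain ⟨d, hd, hno⟩ := hpat
  have : Nonempty D := ⟨d⟩
  choose! t ht htd htw using fun v (hv : v ≠ x) ↦
    I.exists_dominating_value hac hd hno hv (hs.1 v hv)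
  refine ⟨Function.update t x d, fun v _ ↦ ?_, fun v _ w _ hvw ↦ ?_⟩
  · by_cases hv : v = x
    · subst hv
      simpa using hd
    · simpa [hv] using ht v hv
  · by_cases hv : v = x
    · subst hv
      simpa [hvw.symm] using (I.symm _ _ _ _).trans (htd w hvw.symm)
    by_cases hw : w = x
    · subst hw
      simpa [hv] using htd v hv
    have h₁ := htw v hv w hw hvw (s w) (hs.1 w hw) (hs.2 v hv w hw hvw)
    have h₂ := htw w hw v hv hvw.symm (t v) (ht v hv) ((I.symm _ _ _ _).trans h₁)
    simpa [hv, hw] using (I.symm _ _ _ _).trans h₂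
end

section
/- Let I be an arc-consistent binary CSP instance with variable set X, let x ∈ X and let a, b ∈ D(x) be distinct values. Suppose the pattern ∃2snake does not occur at x with this choice of a and b, i.e., there do not exist distinct variables z, y ∈ X∖{x}, values s₀, t₀ ∈ D(z) and a value u ∈ D(y) such that cpt(⟨z,s₀⟩,⟨x,a⟩)=FALSE, cpt(⟨z,t₀⟩,⟨x,a⟩)=TRUE, cpt(⟨z,s₀⟩,⟨x,b⟩)=TRUE, cpt(⟨z,s₀⟩,⟨y,u⟩)=TRUE and cpt(⟨z,t₀⟩,⟨y,u⟩)=FALSE. Then the instance I′ obtained from I by deleting the value b from D(x) is satisfiable if and only if I is satisfiable (that is, the value b can be eliminated). -/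
namespace BinaryCSP

variable {V D : Type}

/-- Deleting the value `b` from the domain of variable `x`. -/
def deleteValue {V D : Type} [DecidableEq V] [DecidableEq D]
    (I : BinaryCSP V D) (x : V) (b : D) : BinaryCSP V D where
  dom := fun v => if v = x then (I.dom x).erase b else I.dom v
  cpt := I.cpt
  symm := I.symm

end BinaryCSP

/-- if the pattern ∃2snake does not occur at `x` on distinct values
`a, b ∈ D(x)` in an arc-consistent binary CSP instance, then the value `b` can be
eliminated: the instance obtained by deleting `b` from `D(x)` is satisfiable iff
the original instance is. -/
theorem exists2snake_val_elim {V D : Type} [Fintype V] [DecidableEq V] [DecidableEq D]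
    (I : BinaryCSP V D)
    (hne : ∀ v, (I.dom v).Nonempty)
    (hac : I.ArcConsistent) (x : V) (a b : D)
    (ha : a ∈ I.dom x) (hb : b ∈ I.dom x) (hab : a ≠ b)
    (hpat : ¬ ∃ (z y : V) (s₀ t₀ : D) (u : D),
      z ≠ x ∧ y ≠ x ∧ z ≠ y ∧
      s₀ ∈ I.dom z ∧ t₀ ∈ I.dom z ∧ u ∈ I.dom y ∧
      I.cpt z s₀ x a = false ∧ I.cpt z t₀ x a = true ∧ I.cpt z s₀ x b = true ∧
      I.cpt z s₀ y u = true ∧ I.cpt z t₀ y u = false) :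
    (∃ s, (I.deleteValue x b).Sol s) ↔ (∃ s, I.Sol s) := by
  constructor
  · rintro ⟨s, hs, hc⟩
    refine ⟨s, fun v _ => ?_, hc⟩
    have hv := hs v trivial
    simp only [BinaryCSP.deleteValue] at hv
    split_ifs at hv with h
    · subst h
      exact Finset.mem_of_mem_erase hv
    · exact hv
  · rintro ⟨s, hs, hc⟩
    by_cases hsx : s x = b
    · have key : ∀ v, ∃ t ∈ I.dom v, v ≠ x → I.cpt v t x a = true ∧
          ∀ y, y ≠ x → v ≠ y → ∀ u ∈ I.dom y,
            I.cpt v (s v) y u = true → I.cpt v t y u = true := by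
        intro v
        by_cases hv : v = x
        · exact ⟨s v, hs v trivial, fun h => absurd hv h⟩
        by_cases hva : I.cpt v (s v) x a = true
        · exact ⟨s v, hs v trivial, fun _ => ⟨hva, fun _ _ _ _ _ h => h⟩⟩
        obtain ⟨t, ht, hat⟩ := hac x a ha v hv
        rw [I.symm] at hat
        refine ⟨t, ht, fun _ => ⟨hat, fun y hy hvy u hu h => ?_⟩⟩
        by_contra hn
        exact hpat ⟨v, y, s v, t, u, hv, hy, hvy, hs v trivial, ht, hu,
          Bool.eq_false_of_not_eq_true hva, hat, hsx ▸ hc v trivial x trivial hv, h,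
          Bool.eq_false_of_not_eq_true hn⟩
      choose t ht htc using key
      refine ⟨Function.update t x a, fun v _ => ?_, fun v _ w _ hvw => ?_⟩
      · by_cases hv : v = x
        · subst hv
          simp [BinaryCSP.deleteValue, ha, hab]
        · simpa [BinaryCSP.deleteValue, hv] using ht v
      · change I.cpt v _ w _ = true
        by_cases hv : v = x
        · subst hv
          rw [Function.update_self, Function.update_of_ne hvw.symm, I.symm]
          exact (htc w hvw.symm).1
        by_cases hw : w = x
        · subst hw
          rw [Function.update_self, Function.update_of_ne hv]
          exact (htc v hv).1
        rw [Function.update_of_ne hv, Function.update_of_ne hw]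
        have hvs : I.cpt v (t v) w (s w) = true :=
          (htc v hv).2 w hw hvw _ (hs w trivial) (hc v trivial w trivial hvw)
        rw [I.symm] at hvs ⊢
        exact (htc w hw).2 v hv hvw.symm _ (ht v) hvs
    · refine ⟨s, fun v _ => ?_, hc⟩
      by_cases hv : v = x
      · subst hv
        simpa [BinaryCSP.deleteValue, hsx] using hs v trivial
      · simpa [BinaryCSP.deleteValue, hv] using hs v trivial
end

section
/- Let I be an arc-consistent binary CSP instance with variable set X, let x ∈ X and let a, b ∈ D(x) be distinct values. Suppose the pattern ∃2invsubBTP does not occur at x with this choice of a and b, i.e., there do not exist distinct variables z, v ∈ X∖{x}, values s₀, t₀ ∈ D(z) and a value u ∈ D(v) such that cpt(⟨z,s₀⟩,⟨x,a⟩)=FALSE, cpt(⟨z,t₀⟩,⟨x,a⟩)=TRUE, cpt(⟨z,s₀⟩,⟨x,b⟩)=TRUE, cpt(⟨v,u⟩,⟨x,a⟩)=TRUE and cpt(⟨z,t₀⟩,⟨v,u⟩)=FALSE. Then the instance I′ obtained from I by deleting the value b from D(x) is satisfiable if and only if I is satisfiable (that is, the value b can be eliminated). -/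
/-- if the pattern ∃2invsubBTP does not occur at `x` on distinct values
`a, b ∈ D(x)` in an arc-consistent binary CSP instance, then the value `b` can be
eliminated: the instance obtained by deleting `b` from `D(x)` is satisfiable iff
the original instance is. -/
theorem exists2invsubBTP_val_elim {V D : Type} [Fintype V] [DecidableEq V] [DecidableEq D]
    (I : BinaryCSP V D)
    (hne : ∀ w, (I.dom w).Nonempty)
    (hac : I.ArcConsistent) (x : V) (a b : D)
    (ha : a ∈ I.dom x) (hb : b ∈ I.dom x) (hab : a ≠ b)
    (hpat : ¬ ∃ (z v : V) (s₀ t₀ : D) (u : D),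
      z ≠ x ∧ v ≠ x ∧ z ≠ v ∧
      s₀ ∈ I.dom z ∧ t₀ ∈ I.dom z ∧ u ∈ I.dom v ∧
      I.cpt z s₀ x a = false ∧ I.cpt z t₀ x a = true ∧ I.cpt z s₀ x b = true ∧
      I.cpt v u x a = true ∧ I.cpt z t₀ v u = false) :
    (∃ s, (I.deleteValue x b).Sol s) ↔ (∃ s, I.Sol s) := by
  constructor
  · rintro ⟨s, hs, hc⟩
    refine ⟨s, fun v _ => ?_, hc⟩
    have hv := hs v trivial
    by_cases hvx : v = x
    · subst hvx
      simp only [BinaryCSP.deleteValue, if_true] at hv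
      exact Finset.mem_of_mem_erase hv
    · simpa [BinaryCSP.deleteValue, hvx] using hv
  · rintro ⟨s, hs, hc⟩
    by_cases hsb : s x = b
    · have hsupp : ∀ z, z ≠ x → ∃ t ∈ I.dom z, I.cpt z t x a = true := fun z hz => by
        obtain ⟨t, ht, h⟩ := hac x a ha z hz
        exact ⟨t, ht, I.symm x a z t ▸ h⟩
      have : Nonempty D := ⟨a⟩
      choose! t ht hta using hsupp
      -- Keep the values of `s` compatible with `a`; replace the others by supports of `a`.
      let s' : V → D := fun z =>
        if z = x then a else if I.cpt z (s z) x a = true then s z else t z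
      have hx : s' x = a := if_pos rfl
      have hdom : ∀ z, z ≠ x → s' z ∈ I.dom z := fun z hz => by
        simp only [s', if_neg hz]
        split_ifs
        exacts [hs z trivial, ht z hz]
      have hcpt : ∀ z, z ≠ x → I.cpt z (s' z) x a = true := fun z hz => by
        simp only [s', if_neg hz]
        split_ifs with h
        exacts [h, hta z hz]
      have hreplaced : ∀ z v, z ≠ x → v ≠ x → z ≠ v → I.cpt z (s z) x a = false →
          I.cpt z (s' z) v (s' v) = true := fun z v hz hv hzv h => by
        by_contra hf
        exact hpat ⟨z, v, s z, s' z, s' v, hz, hv, hzv, hs z trivial, hdom z hz, hdom v hv, h,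
          hcpt z hz, hsb ▸ hc z trivial x trivial hz, hcpt v hv, Bool.eq_false_iff.mpr hf⟩
      refine ⟨s', fun z _ => ?_, fun z _ v _ hzv => ?_⟩
      · by_cases hz : z = x
        · subst hz
          simpa [BinaryCSP.deleteValue, hx] using And.intro hab ha
        · simpa [BinaryCSP.deleteValue, hz] using hdom z hz
      · change I.cpt z (s' z) v (s' v) = true
        by_cases hz : z = x
        · rw [I.symm, hz, hx]
          exact hcpt v fun h => hzv (hz.trans h.symm)
        by_cases hv : v = x
        · rw [hv, hx]
          exact hcpt z hz
        by_cases hza : I.cpt z (s z) x a = true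
        · by_cases hva : I.cpt v (s v) x a = true
          · simpa [s', hz, hv, hza, hva] using hc z trivial v trivial hzv
          · rw [I.symm]
            exact hreplaced v z hv hz hzv.symm (Bool.eq_false_iff.mpr hva)
        · exact hreplaced z v hz hv hzv (Bool.eq_false_iff.mpr hza)
    · refine ⟨s, fun v _ => ?_, hc⟩
      have hv := hs v trivial
      by_cases hvx : v = x
      · subst hvx
        simpa [BinaryCSP.deleteValue] using And.intro hsb hv
      · simpa [BinaryCSP.deleteValue, hvx] using hv
end

section
/- Let I be an arc-consistent binary CSP instance with variable set X, let x ∈ X and let a, b ∈ D(x) be distinct values. Suppose the pattern ∃2triangle does not occur at x with this choice of a and b, i.e., there do not exist distinct variables y, z ∈ X∖{x}, a value p ∈ D(y) and a value q ∈ D(z) such that cpt(⟨y,p⟩,⟨z,q⟩)=TRUE, cpt(⟨y,p⟩,⟨x,b⟩)=TRUE, cpt(⟨z,q⟩,⟨x,b⟩)=TRUE and cpt(⟨y,p⟩,⟨x,a⟩)=FALSE. Then the instance I′ obtained from I by deleting the value b from D(x) is satisfiable if and only if I is satisfiable (that is, the value b can be eliminated). -/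
/-- if the pattern ∃2triangle does not occur at `x` on distinct values
`a, b ∈ D(x)` in an arc-consistent binary CSP instance, then the value `b` can be
eliminated: the instance obtained by deleting `b` from `D(x)` is satisfiable iff
the original instance is. -/
theorem exists2triangle_val_elim {V D : Type} [Fintype V] [DecidableEq V] [DecidableEq D]
    (I : BinaryCSP V D)
    (hne : ∀ w, (I.dom w).Nonempty)
    (hac : I.ArcConsistent) (x : V) (a b : D)
    (ha : a ∈ I.dom x) (hb : b ∈ I.dom x) (hab : a ≠ b)
    (hpat : ¬ ∃ (y z : V) (p : D) (q : D),
      y ≠ x ∧ z ≠ x ∧ y ≠ z ∧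
      p ∈ I.dom y ∧ q ∈ I.dom z ∧
      I.cpt y p z q = true ∧ I.cpt y p x b = true ∧
      I.cpt z q x b = true ∧ I.cpt y p x a = false) :
    (∃ s, (I.deleteValue x b).Sol s) ↔ (∃ s, I.Sol s) := by
  constructor
  · rintro ⟨s, hs, hc⟩
    refine ⟨s, fun v _ => ?_, hc⟩
    have h := hs v trivial
    simp only [BinaryCSP.deleteValue] at h
    split_ifs at h with hv
    · subst hv
      exact Finset.mem_of_mem_erase h
    · exact h
  · rintro ⟨s, hs, hc⟩
    suffices h : ∃ t, I.Sol t ∧ t x ≠ b by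
      obtain ⟨t, ⟨ht, htc⟩, htb⟩ := h
      refine ⟨t, fun v _ => ?_, htc⟩
      simp only [BinaryCSP.deleteValue]
      split_ifs with hv
      · subst hv
        exact Finset.mem_erase.2 ⟨htb, ht v trivial⟩
      · exact ht v trivial
    by_cases hsb : s x = b
    · by_cases hy : ∃ y, y ≠ x ∧ I.cpt y (s y) x a = false
      · obtain ⟨y, hyx, hya⟩ := hy
        have only_two : ∀ z, z ≠ x → z = y := by
          intro z hzx
          by_contra hzy
          exact hpat ⟨y, z, s y, s z, hyx, hzx, Ne.symm hzy, hs y trivial, hs z trivial,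
            hc y trivial z trivial (Ne.symm hzy), hsb ▸ hc y trivial x trivial hyx,
            hsb ▸ hc z trivial x trivial hzx, hya⟩
        obtain ⟨c, hcy, hac'⟩ := hac x a ha y hyx
        refine ⟨fun v => if v = x then a else c, ⟨fun v _ => ?_, fun v _ w _ hvw => ?_⟩, ?_⟩
        · by_cases hv : v = x
          · simpa [hv] using ha
          · simpa [only_two v hv, hyx] using hcy
        · by_cases hv : v = x
          · have hw : w ≠ x := fun h => hvw (hv.trans h.symm)
            simpa [hv, only_two w hw, hyx] using hac'
          · by_cases hw : w = x
            · simpa [hw, only_two v hv, hyx] using (I.symm y c x a).trans hac'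
            · exact absurd ((only_two v hv).trans (only_two w hw).symm) hvw
        · simpa using hab
      · have ha_compat : ∀ y, y ≠ x → I.cpt y (s y) x a = true := fun y hyx =>
          Bool.eq_true_of_not_eq_false fun h => hy ⟨y, hyx, h⟩
        refine ⟨Function.update s x a, ⟨fun v _ => ?_, fun v _ w _ hvw => ?_⟩, by simpa using hab⟩
        · by_cases hv : v = x
          · subst hv
            simpa using ha
          · simpa [hv] using hs v trivial
        · by_cases hv : v = x
          · subst hv
            simpa [hvw.symm] using (I.symm v a w (s w)).trans (ha_compat w hvw.symm)
          · by_cases hw : w = x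
            · subst hw
              simpa [hv] using ha_compat v hv
            · simpa [hv, hw] using hc v trivial w trivial hvw
    · exact ⟨s, ⟨hs, hc⟩, hsb⟩
end

section
/- Let I be an arc-consistent binary CSP instance with variable set X and let x ∈ X. Suppose there exists a value d ∈ D(x) such that there do not exist distinct variables y, z ∈ X∖{x}, values p ∈ D(y), q ∈ D(z) and a value b ∈ D(x) with cpt(⟨y,p⟩,⟨z,q⟩)=TRUE, cpt(⟨y,p⟩,⟨x,b⟩)=TRUE, cpt(⟨z,q⟩,⟨x,b⟩)=FALSE and cpt(⟨y,p⟩,⟨x,d⟩)=FALSE (non-occurrence of ∃subBTP at x with a ↦ d). Then every partial solution s on X∖{x} extends to a solution of I: there is a value c ∈ D(x) such that the map agreeing with s on X∖{x} and assigning c to x is a solution of I. -/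
namespace BinaryCSP

/-- A partial solution off `x` together with a value of `x` compatible with all of it is a
solution. -/
theorem PartialSol.sol_update {V D : Type} [DecidableEq V] {I : BinaryCSP V D} {x : V}
    {s : V → D} (hs : I.PartialSol {v | v ≠ x} s) {c : D} (hc : c ∈ I.dom x)
    (h : ∀ v, v ≠ x → I.cpt v (s v) x c = true) : I.Sol (Function.update s x c) := by
  refine ⟨fun v _ => ?_, fun v _ w _ hvw => ?_⟩
  · by_cases hv : v = x
    · subst hv
      simpa using hc
    · simpa [hv] using hs.1 v hv
  · by_cases hv : v = x
    · subst hv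
      have hw : w ≠ v := hvw.symm
      simpa [hw] using (I.symm v c w (s w)).trans (h w hw)
    · by_cases hw : w = x
      · subst hw
        simpa [hv] using h v hv
      · simpa [hv, hw] using hs.2 v hv w hw hvw

end BinaryCSP

/-- if ∃subBTP does not occur at `x` with the mapping `a ↦ d` in an
arc-consistent binary CSP instance, then every partial solution on the variables
other than `x` extends to a solution by assigning some value `c ∈ D(x)` to `x`. -/
theorem existsSubBTP_extend {V D : Type} [Fintype V] [DecidableEq V] (I : BinaryCSP V D)
    (hne : ∀ v, (I.dom v).Nonempty)
    (hac : I.ArcConsistent) (x : V)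
    (hpat : ∃ d ∈ I.dom x, ¬ ∃ (y z : V) (p q : D) (b : D),
      y ≠ x ∧ z ≠ x ∧ y ≠ z ∧
      p ∈ I.dom y ∧ q ∈ I.dom z ∧ b ∈ I.dom x ∧
      I.cpt y p z q = true ∧ I.cpt y p x b = true ∧
      I.cpt z q x b = false ∧ I.cpt y p x d = false) :
    ∀ s : V → D, I.PartialSol {v | v ≠ x} s →
      ∃ c ∈ I.dom x, I.Sol (Function.update s x c) := by
  intro s hs
  obtain ⟨d, hd, hpat⟩ := hpat
  by_cases hall : ∀ v, v ≠ x → I.cpt v (s v) x d = true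
  · exact ⟨d, hd, hs.sol_update hd hall⟩
  push Not at hall
  obtain ⟨y, hy, hyd⟩ := hall
  obtain ⟨b, hb, hyb⟩ := hac y (s y) (hs.1 y hy) x hy.symm
  refine ⟨b, hb, hs.sol_update hb fun z hz => ?_⟩
  by_contra hzb
  have hyz : y ≠ z := by
    rintro rfl
    exact hzb hyb
  exact hpat ⟨y, z, s y, s z, b, hy, hz, hyz, hs.1 y hy, hs.1 z hz, hb, hs.2 y hy z hz hyz, hyb,
    Bool.eq_false_of_not_eq_true hzb, Bool.eq_false_of_not_eq_true hyd⟩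
end

section
/- Let I be an arc-consistent binary CSP instance with variable set X, let x ∈ X and let d ∈ D(x) be such that there do not exist distinct variables y, z ∈ X∖{x}, values s₀, t₀ ∈ D(y) and a value u ∈ D(z) with cpt(⟨y,s₀⟩,⟨x,d⟩)=FALSE, cpt(⟨y,t₀⟩,⟨x,d⟩)=TRUE, cpt(⟨z,u⟩,⟨x,d⟩)=TRUE and cpt(⟨y,t₀⟩,⟨z,u⟩)=FALSE (non-occurrence of ∃invsubBTP at x with a ↦ d). Then for every partial solution s on X∖{x} there is a solution s′ of I with s′(x)=d and s′(y)=s(y) for every y ∈ X∖{x} such that cpt(⟨y,s(y)⟩,⟨x,d⟩)=TRUE. -/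
/-- if ∃invsubBTP does not occur at `x` with the mapping `a ↦ d` in an
arc-consistent binary CSP instance, then every partial solution `s` on the variables
other than `x` yields a solution `s'` with `s' x = d` which agrees with `s` on every
variable `y ≠ x` whose assignment `s y` is compatible with `⟨x,d⟩`. -/
theorem existsInvsubBTP_extend {V D : Type} [Fintype V] (I : BinaryCSP V D)
    (hne : ∀ v, (I.dom v).Nonempty)
    (hac : I.ArcConsistent) (x : V) (d : D) (hd : d ∈ I.dom x)
    (hpat : ¬ ∃ (y z : V) (s₀ t₀ : D) (u : D),
      y ≠ x ∧ z ≠ x ∧ y ≠ z ∧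
      s₀ ∈ I.dom y ∧ t₀ ∈ I.dom y ∧ u ∈ I.dom z ∧
      I.cpt y s₀ x d = false ∧ I.cpt y t₀ x d = true ∧
      I.cpt z u x d = true ∧ I.cpt y t₀ z u = false) :
    ∀ s : V → D, I.PartialSol {v | v ≠ x} s →
      ∃ s' : V → D, I.Sol s' ∧ s' x = d ∧
        ∀ y, y ≠ x → I.cpt y (s y) x d = true → s' y = s y := by
  classical
  have : Nonempty D := ⟨d⟩
  intro s hs
  choose! t ht htx using fun v (hv : v ≠ x) => hac x d hd v hv
  obtain ⟨hdom, hcpt⟩ := hs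
  let r : V → D := fun v => if I.cpt v (s v) x d = true then s v else t v
  have hr_dom : ∀ v, v ≠ x → r v ∈ I.dom v := by
    intro v hv
    by_cases h : I.cpt v (s v) x d = true
    · simpa [r, h] using hdom v hv
    · simpa [r, h] using ht v hv
  have hr_x : ∀ v, v ≠ x → I.cpt v (r v) x d = true := by
    intro v hv
    by_cases h : I.cpt v (s v) x d = true
    · simp [r, h]
    · simpa [r, h, I.symm v] using htx v hv
  have hr_of_changed : ∀ v w, v ≠ x → w ≠ x → v ≠ w → I.cpt v (s v) x d = false →
      I.cpt v (r v) w (r w) = true := by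
    intro v w hv hw hvw h
    by_contra hc
    exact hpat ⟨v, w, s v, r v, r w, hv, hw, hvw, hdom v hv, hr_dom v hv, hr_dom w hw, h,
      hr_x v hv, hr_x w hw, by simpa using hc⟩
  have hr_cpt : ∀ v w, v ≠ x → w ≠ x → v ≠ w → I.cpt v (r v) w (r w) = true := by
    intro v w hv hw hvw
    cases h : I.cpt v (s v) x d with
    | false => exact hr_of_changed v w hv hw hvw h
    | true =>
      cases h' : I.cpt w (s w) x d with
      | false => exact I.symm v _ w _ ▸ hr_of_changed w v hw hv hvw.symm h'
      | true => simpa [r, h, h'] using hcpt v hv w hw hvw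
  refine ⟨Function.update r x d, ⟨fun v _ => ?_, fun v _ w _ hvw => ?_⟩, by simp,
    fun y hy h => by simp [hy, r, h]⟩
  · by_cases hv : v = x
    · subst hv; simpa using hd
    · simpa [hv] using hr_dom v hv
  · by_cases hv : v = x
    · subst hv
      simpa [hvw.symm, I.symm v] using hr_x w hvw.symm
    · by_cases hw : w = x
      · subst hw
        simpa [hv] using hr_x v hv
      · simpa [hv, hw] using hr_cpt v w hv hw hvw
end

section
/- Let I be a binary CSP instance with variable set X, |X| ≥ 3, let x ∈ X and let a, b ∈ D(x) be distinct values such that there do not exist distinct variables y, z ∈ X∖{x}, a value p ∈ D(y) and a value q ∈ D(z) with cpt(⟨y,p⟩,⟨z,q⟩)=TRUE, cpt(⟨y,p⟩,⟨x,b⟩)=TRUE, cpt(⟨z,q⟩,⟨x,b⟩)=TRUE and cpt(⟨y,p⟩,⟨x,a⟩)=FALSE (non-occurrence of ∃2triangle at x on a,b). Then for every solution s of I with s(x)=b, the map s″ defined by s″(x)=a and s″(v)=s(v) for v ≠ x is also a solution of I. -/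
/-- in a binary CSP instance with at least 3 variables, if ∃2triangle
does not occur at `x` on distinct values `a, b ∈ D(x)`, then replacing the value `b`
by `a` at `x` in any solution again yields a solution. -/
theorem exists2triangle_substitute {V D : Type} [Fintype V] [DecidableEq V]
    (I : BinaryCSP V D)
    (hcard : 3 ≤ Fintype.card V)
    (x : V) (a b : D)
    (ha : a ∈ I.dom x) (hb : b ∈ I.dom x) (hab : a ≠ b)
    (hpat : ¬ ∃ (y z : V) (p : D) (q : D),
      y ≠ x ∧ z ≠ x ∧ y ≠ z ∧
      p ∈ I.dom y ∧ q ∈ I.dom z ∧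
      I.cpt y p z q = true ∧ I.cpt y p x b = true ∧
      I.cpt z q x b = true ∧ I.cpt y p x a = false) :
    ∀ s : V → D, I.Sol s → s x = b → I.Sol (Function.update s x a) := by
  rintro s ⟨hdom, hcpt⟩ rfl
  have compat : ∀ v w, v ≠ w → I.cpt v (s v) w (s w) = true :=
    fun v w h => hcpt v trivial w trivial h
  have compat_a : ∀ y, y ≠ x → I.cpt y (s y) x a = true := by
    intro y hy
    by_contra hya
    obtain ⟨z, hz⟩ : ∃ z, z ∉ ({x, y} : Finset V) :=
      Finset.exists_mem_notMem_of_card_lt_card (s := {x, y}) (t := Finset.univ)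
        (by rw [Finset.card_univ]; exact Finset.card_le_two.trans_lt hcard) |>.imp
        fun _ h => h.2
    simp only [Finset.mem_insert, Finset.mem_singleton, not_or] at hz
    exact hpat ⟨y, z, s y, s z, hy, hz.1, Ne.symm hz.2, hdom y trivial, hdom z trivial,
      compat y z (Ne.symm hz.2), compat y x hy, compat z x hz.1, Bool.eq_false_iff.mpr hya⟩
  refine ⟨fun v _ => ?_, fun v _ w _ hvw => ?_⟩
  · by_cases hv : v = x
    · subst hv
      simpa using ha
    · simpa [hv] using hdom v trivial
  · by_cases hv : v = x
    · subst hv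
      simpa [hvw.symm, I.symm v] using compat_a w hvw.symm
    · by_cases hw : w = x
      · subst hw
        simpa [hv] using compat_a v hv
      · simpa [hv, hw] using compat v w hvw
end

section
/- An irreducible flat quantified pattern P allows variable elimination in arc-consistent binary CSP instances (i.e., P is a var-elim pattern) if and only if P is equivalent to one of the patterns BTP, invsubBTP, snake, or to an irreducible sub-pattern of one of them. Here BTP is the flat quantified pattern with variables y, z, x (x distinguished), domains D(y)={p}, D(z)={q}, D(x)={c,d}, and compatibilities cpt(p,q)=TRUE, cpt(p,c)=TRUE, cpt(q,d)=TRUE, cpt(p,d)=FALSE, cpt(q,c)=FALSE; invsubBTP is the flat quantified pattern with variables y, z, x (x distinguished), domains D(y)={s,t}, D(z)={u}, D(x)={d}, and compatibilities cpt(s,d)=FALSE, cpt(t,d)=TRUE, cpt(u,d)=TRUE, cpt(t,u)=FALSE; snake is the flat quantified pattern with variables y, z, x (x distinguished), domains D(y)={s,t}, D(z)={u}, D(x)={d}, and compatibilities cpt(s,d)=FALSE, cpt(t,d)=TRUE, cpt(s,u)=TRUE, cpt(t,u)=FALSE. -/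
/-- A quantified pattern: a finite set `X` of variables (named by naturals), a finite
set `A ⊆ X × ℕ` of assignments (each variable having a nonempty domain), a partial
symmetric compatibility function `cpt` defined only on pairs of assignments to
distinct variables, a distinguished variable `vbar ∈ X`, a set `e` of existential
values of `vbar`, and an optional distinguished value `valbar ∈ e`.  A flat
quantified pattern has `e = ∅` and an existential pattern has `e ≠ ∅`; patterns
without a distinguished value have `valbar = none`. -/
structure QPattern where
  X : Finset ℕ
  A : Finset (ℕ × ℕ)
  cpt : ℕ × ℕ → ℕ × ℕ → Option Bool
  cpt_symm : ∀ p q, cpt p q = cpt q p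
  cpt_dom : ∀ p q, (cpt p q).isSome → p ∈ A ∧ q ∈ A ∧ p.1 ≠ q.1
  A_sub : ∀ p ∈ A, p.1 ∈ X
  dom_ne : ∀ v ∈ X, ∃ a, (v, a) ∈ A
  vbar : ℕ
  vbar_mem : vbar ∈ X
  e : Finset ℕ
  e_sub : ∀ a ∈ e, (vbar, a) ∈ A
  valbar : Option ℕ
  valbar_mem : ∀ b, valbar = some b → b ∈ e

namespace QPattern

/-- A flat quantified pattern: no existential values. -/
def Flat (P : QPattern) : Prop := P.e = ∅

/-- An existential pattern: at least one existential value. -/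
def Existential (P : QPattern) : Prop := P.e.Nonempty

/-- Values `a` and `b` of variable `v` are mergeable (`a` may be merged into `b`):
no assignment has defined and unequal compatibilities with `⟨v,a⟩` and `⟨v,b⟩`, and
if `a` is an existential value of the distinguished variable then so is `b`. -/
def Mergeable (P : QPattern) (v a b : ℕ) : Prop :=
  (v, a) ∈ P.A ∧ (v, b) ∈ P.A ∧ a ≠ b ∧
  (∀ p, (P.cpt (v, a) p).isSome → (P.cpt (v, b) p).isSome →
    P.cpt (v, a) p = P.cpt (v, b) p) ∧
  (v = P.vbar → a ∈ P.e → b ∈ P.e)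

/-- A dangling assignment: it appears in at most one defined compatibility, which
(if defined) is TRUE, and it is not an existential assignment of the distinguished
variable. -/
def Dangling (P : QPattern) (p : ℕ × ℕ) : Prop :=
  p ∈ P.A ∧
  (∀ q r, (P.cpt p q).isSome → (P.cpt p r).isSome → q = r) ∧
  (∀ q, (P.cpt p q).isSome → P.cpt p q = some true) ∧
  ¬ (p.1 = P.vbar ∧ p.2 ∈ P.e)

/-- An irreducible pattern: no merge or dangling reduction can be performed. -/
def Irreducible (P : QPattern) : Prop :=
  (∀ v a b, ¬ P.Mergeable v a b) ∧ (∀ p, ¬ P.Dangling p)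

/-- The merge reduction merging value `a` of variable `v` into value `b`:
the assignment `⟨v,a⟩` is deleted and its defined compatibilities are transferred
to `⟨v,b⟩` where previously undefined. -/
def MergeStep (P Q : QPattern) (v a b : ℕ) : Prop :=
  P.Mergeable v a b ∧
  Q.X = P.X ∧ Q.A = P.A.erase (v, a) ∧
  Q.vbar = P.vbar ∧
  Q.e = (if v = P.vbar then P.e.erase a else P.e) ∧
  Q.valbar = (if v = P.vbar ∧ P.valbar = some a then some b else P.valbar) ∧
  (∀ p q, Q.cpt p q =
    if p = (v, a) ∨ q = (v, a) then none
    else if p = (v, b) ∧ P.cpt p q = none then P.cpt (v, a) q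
    else if q = (v, b) ∧ P.cpt p q = none then P.cpt p (v, a)
    else P.cpt p q)

/-- The dangling reduction deleting a dangling assignment `p`. -/
def DanglingStep (P Q : QPattern) (p : ℕ × ℕ) : Prop :=
  P.Dangling p ∧
  Q.X = P.X ∧ Q.A = P.A.erase p ∧
  Q.vbar = P.vbar ∧ Q.e = P.e ∧ Q.valbar = P.valbar ∧
  (∀ q r, Q.cpt q r = if q = p ∨ r = p then none else P.cpt q r)

/-- `ReducesTr P R tr`: `R` is obtained from `P` by a sequence of merge and dangling
reductions, and `tr` traces each (existential) value of the distinguished variable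
of `P` to the value of the distinguished variable of `R` it has been merged into. -/
inductive ReducesTr : QPattern → QPattern → (ℕ → ℕ) → Prop
  | refl (P : QPattern) : ReducesTr P P id
  | merge {P Q R : QPattern} {v a b : ℕ} {tr : ℕ → ℕ} :
      MergeStep P Q v a b → ReducesTr Q R tr →
      ReducesTr P R (fun c => tr (if v = P.vbar ∧ c = a then b else c))
  | dangling {P Q R : QPattern} {p : ℕ × ℕ} {tr : ℕ → ℕ} :
      DanglingStep P Q p → ReducesTr Q R tr → ReducesTr P R tr

/-- `IsEmbedding R Q fX fD`: the pattern `R` is equivalent, via the injective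
renaming `fX` of variables and `fD` of assignments (assignment `(v,a)` being
renamed to `(fX v, fD v a)`), to a sub-pattern of `Q` (ignoring quantification). -/
def IsEmbedding (R Q : QPattern) (fX : ℕ → ℕ) (fD : ℕ → ℕ → ℕ) : Prop :=
  Set.InjOn fX ↑R.X ∧
  (∀ v ∈ R.X, fX v ∈ Q.X) ∧
  (∀ p ∈ R.A, (fX p.1, fD p.1 p.2) ∈ Q.A) ∧
  (∀ v, Set.InjOn (fD v) {a | (v, a) ∈ R.A}) ∧
  (∀ p ∈ R.A, ∀ q ∈ R.A, (R.cpt p q).isSome →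
    Q.cpt (fX p.1, fD p.1 p.2) (fX q.1, fD q.1 q.2) = R.cpt p q)

/-- The quantified pattern `P` occurs at variable `x` of `Q` with value mapping `m`:
some reduction `R` of `P` is equivalent to a sub-pattern of `Q`, the distinguished
variable of `R` corresponding to `x` and the values of `x` corresponding to the
existential values of `P` being given by `m`. -/
def OccursAtWith (P Q : QPattern) (x : ℕ) (m : ℕ → ℕ) : Prop :=
  ∃ R tr, ReducesTr P R tr ∧
    ∃ fX fD, IsEmbedding R Q fX fD ∧ fX R.vbar = x ∧
      ∀ a ∈ P.e, fD R.vbar (tr a) = m a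

/-- The quantified pattern `P` occurs in the quantified pattern `Q`: some reduction
of `P` is equivalent to a sub-pattern of `Q` (preserving the distinguished variable,
existential values and the distinguished value, as required of sub-patterns of
quantified patterns). -/
def OccursIn (P Q : QPattern) : Prop :=
  ∃ R tr, ReducesTr P R tr ∧
    ∃ fX fD, IsEmbedding R Q fX fD ∧ fX R.vbar = Q.vbar ∧
      (∀ a ∈ R.e, fD R.vbar a ∈ Q.e) ∧
      (∀ b, R.valbar = some b → Q.valbar = some (fD R.vbar b))

/-- A binary CSP instance: a pattern whose compatibility function is total. -/
def IsInstance (Q : QPattern) : Prop :=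
  ∀ p ∈ Q.A, ∀ q ∈ Q.A, p.1 ≠ q.1 → (Q.cpt p q).isSome

/-- Arc consistency: every assignment has a compatible assignment at every other
variable. -/
def ArcCons (Q : QPattern) : Prop :=
  ∀ p ∈ Q.A, ∀ w ∈ Q.X, w ≠ p.1 → ∃ b, (w, b) ∈ Q.A ∧ Q.cpt p (w, b) = some true

/-- A partial solution on the set `Y` of variables. -/
def PartialSol (Q : QPattern) (Y : Finset ℕ) (s : ℕ → ℕ) : Prop :=
  (∀ v ∈ Y, (v, s v) ∈ Q.A) ∧
  ∀ v ∈ Y, ∀ w ∈ Y, v ≠ w → Q.cpt (v, s v) (w, s w) = some true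

/-- A solution: a partial solution on all the variables. -/
def Sol (Q : QPattern) (s : ℕ → ℕ) : Prop :=
  Q.PartialSol Q.X s

/-- A variable elimination pattern: whenever `P` does not occur at a variable `x`
of an arc-consistent binary CSP instance for at least one injective value mapping,
the variable `x` can be eliminated (any partial solution on the other variables
guarantees a solution). -/
def VarElimPattern (P : QPattern) : Prop :=
  ∀ Q : QPattern, Q.IsInstance → Q.ArcCons → ∀ x ∈ Q.X,
    (∃ m : ℕ → ℕ, Set.InjOn m ↑P.e ∧ (∀ a ∈ P.e, (x, m a) ∈ Q.A) ∧
      ¬ OccursAtWith P Q x m) →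
    (∃ s, Q.PartialSol (Q.X.erase x) s) → ∃ s, Q.Sol s

/-- A value elimination pattern: whenever `P` (with distinguished value `b`) does
not occur at a variable `x` of an arc-consistent binary CSP instance for an
injective value mapping `m`, the value `m b` can be eliminated from the domain of
`x`: the instance obtained by deleting the assignment `⟨x, m b⟩` is satisfiable
iff the original instance is.  (A solution of the instance with `⟨x, m b⟩` deleted
is exactly a solution `s` of the original instance with `s x ≠ m b`.) -/
def ValElimPattern (P : QPattern) : Prop :=
  ∀ Q : QPattern, Q.IsInstance → Q.ArcCons → ∀ x ∈ Q.X, ∀ m : ℕ → ℕ,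
    Set.InjOn m ↑P.e → (∀ a ∈ P.e, (x, m a) ∈ Q.A) → ¬ OccursAtWith P Q x m →
    ∀ b, P.valbar = some b → ((∃ s, Q.Sol s ∧ s x ≠ m b) ↔ ∃ s, Q.Sol s)

/-- Two quantified patterns are equivalent: isomorphic via injective renamings of
variables and assignments preserving domains, compatibilities, the distinguished
variable, the existential values and the distinguished value. -/
def EquivPat (P Q : QPattern) : Prop :=
  ∃ (fX : ℕ → ℕ) (fD : ℕ → ℕ → ℕ),
    Set.BijOn fX ↑P.X ↑Q.X ∧
    Set.BijOn (fun p : ℕ × ℕ => (fX p.1, fD p.1 p.2)) ↑P.A ↑Q.A ∧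
    (∀ p ∈ P.A, ∀ q ∈ P.A,
      Q.cpt (fX p.1, fD p.1 p.2) (fX q.1, fD q.1 q.2) = P.cpt p q) ∧
    fX P.vbar = Q.vbar ∧
    Q.e = P.e.image (fD P.vbar) ∧
    Q.valbar = P.valbar.map (fD P.vbar)

/-- `P'` is a sub-pattern of `P`. -/
def SubPat (P' P : QPattern) : Prop :=
  P'.X ⊆ P.X ∧ P'.A ⊆ P.A ∧
  (∀ p q, (P'.cpt p q).isSome → P'.cpt p q = P.cpt p q) ∧
  P'.vbar = P.vbar ∧ P'.e ⊆ P.e ∧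
  (∀ b, P'.valbar = some b → P.valbar = some b)

end QPattern

/-- Partial compatibility function given by a finite list of (unordered) edges. -/
def ofList (l : List ((ℕ × ℕ) × (ℕ × ℕ) × Bool)) (p q : ℕ × ℕ) : Option Bool :=
  (l.find? fun t => (t.1 == p && t.2.1 == q) || (t.1 == q && t.2.1 == p)).map (·.2.2)

theorem ofList_symm (l : List ((ℕ × ℕ) × (ℕ × ℕ) × Bool)) (p q : ℕ × ℕ) :
    ofList l p q = ofList l q p := by
  unfold ofList
  have h : (fun t : (ℕ × ℕ) × (ℕ × ℕ) × Bool =>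
        (t.1 == p && t.2.1 == q) || (t.1 == q && t.2.1 == p))
      = (fun t => (t.1 == q && t.2.1 == p) || (t.1 == p && t.2.1 == q)) := by
    funext t; exact Bool.or_comm _ _
  rw [h]

theorem ofList_isSome {l : List ((ℕ × ℕ) × (ℕ × ℕ) × Bool)} {p q : ℕ × ℕ}
    (h : (ofList l p q).isSome) :
    ∃ t ∈ l, (t.1 = p ∧ t.2.1 = q) ∨ (t.1 = q ∧ t.2.1 = p) := by
  unfold ofList at h
  cases hf : l.find? fun t => (t.1 == p && t.2.1 == q) || (t.1 == q && t.2.1 == p) with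
  | none => rw [hf] at h; simp at h
  | some t =>
    refine ⟨t, List.mem_of_find?_eq_some hf, ?_⟩
    have hp := List.find?_some hf
    simp only [Bool.or_eq_true, Bool.and_eq_true, beq_iff_eq] at hp
    exact hp

/-- The flat quantified pattern BTP: variables `y=0`, `z=1`, `x=2` (distinguished),
assignments `p=(0,0)`, `q=(1,0)`, `c=(2,0)`, `d=(2,1)`; edges `cpt(p,q)=T`,
`cpt(p,c)=T`, `cpt(q,d)=T`, `cpt(p,d)=F`, `cpt(q,c)=F`. -/
def BTPpat : QPattern where
  X := {0, 1, 2}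
  A := {(0, 0), (1, 0), (2, 0), (2, 1)}
  cpt := ofList [((0, 0), (1, 0), true), ((0, 0), (2, 0), true), ((1, 0), (2, 1), true),
                 ((0, 0), (2, 1), false), ((1, 0), (2, 0), false)]
  cpt_symm := fun p q => ofList_symm _ p q
  cpt_dom := by
    intro p q h
    obtain ⟨t, ht, hpq⟩ := ofList_isSome h
    simp only [List.mem_cons, List.not_mem_nil, or_false] at ht
    rcases ht with rfl | rfl | rfl | rfl | rfl <;>
      rcases hpq with ⟨rfl, rfl⟩ | ⟨rfl, rfl⟩ <;> decide
  A_sub := by decide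
  dom_ne := by intro v hv; fin_cases hv <;> exact ⟨0, by decide⟩
  vbar := 2
  vbar_mem := by decide
  e := ∅
  e_sub := by intro a ha; simp at ha
  valbar := none
  valbar_mem := by intro b h; cases h

/-- The flat quantified pattern invsubBTP: variables `y=0`, `z=1`, `x=2`
(distinguished), assignments `s=(0,0)`, `t=(0,1)`, `u=(1,0)`, `d=(2,0)`; edges
`cpt(s,d)=F`, `cpt(t,d)=T`, `cpt(u,d)=T`, `cpt(t,u)=F`. -/
def invsubBTPpat : QPattern where
  X := {0, 1, 2}
  A := {(0, 0), (0, 1), (1, 0), (2, 0)}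
  cpt := ofList [((0, 0), (2, 0), false), ((0, 1), (2, 0), true), ((1, 0), (2, 0), true),
                 ((0, 1), (1, 0), false)]
  cpt_symm := fun p q => ofList_symm _ p q
  cpt_dom := by
    intro p q h
    obtain ⟨t, ht, hpq⟩ := ofList_isSome h
    simp only [List.mem_cons, List.not_mem_nil, or_false] at ht
    rcases ht with rfl | rfl | rfl | rfl <;>
      rcases hpq with ⟨rfl, rfl⟩ | ⟨rfl, rfl⟩ <;> decide
  A_sub := by decide
  dom_ne := by intro v hv; fin_cases hv <;> exact ⟨0, by decide⟩
  vbar := 2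
  vbar_mem := by decide
  e := ∅
  e_sub := by intro a ha; simp at ha
  valbar := none
  valbar_mem := by intro b h; cases h

/-- The flat quantified pattern snake: variables `y=0`, `z=1`, `x=2`
(distinguished), assignments `s=(0,0)`, `t=(0,1)`, `u=(1,0)`, `d=(2,0)`; edges
`cpt(s,d)=F`, `cpt(t,d)=T`, `cpt(s,u)=T`, `cpt(t,u)=F`. -/
def snakePat : QPattern where
  X := {0, 1, 2}
  A := {(0, 0), (0, 1), (1, 0), (2, 0)}
  cpt := ofList [((0, 0), (2, 0), false), ((0, 1), (2, 0), true), ((0, 0), (1, 0), true),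
                 ((0, 1), (1, 0), false)]
  cpt_symm := fun p q => ofList_symm _ p q
  cpt_dom := by
    intro p q h
    obtain ⟨t, ht, hpq⟩ := ofList_isSome h
    simp only [List.mem_cons, List.not_mem_nil, or_false] at ht
    rcases ht with rfl | rfl | rfl | rfl <;>
      rcases hpq with ⟨rfl, rfl⟩ | ⟨rfl, rfl⟩ <;> decide
  A_sub := by decide
  dom_ne := by intro v hv; fin_cases hv <;> exact ⟨0, by decide⟩
  vbar := 2
  vbar_mem := by decide
  e := ∅
  e_sub := by intro a ha; simp at ha
  valbar := none
  valbar_mem := by intro b h; cases h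

namespace QPattern

/-- The pattern `P` is, via injective renamings, a sub-pattern of `Q` with the distinguished
variable of `P` renamed to `x`. -/
def Embeds (P Q : QPattern) (x : ℕ) : Prop :=
  ∃ fX fD, IsEmbedding P Q fX fD ∧ fX P.vbar = x

theorem Embeds.trans {P R Q : QPattern} {x : ℕ} (h₁ : P.Embeds R R.vbar) (h₂ : R.Embeds Q x) :
    P.Embeds Q x := by
  obtain ⟨fX, fD, ⟨f1, f2, f3, f4, f5⟩, fv⟩ := h₁
  obtain ⟨gX, gD, ⟨g1, g2, g3, g4, g5⟩, gv⟩ := h₂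
  refine ⟨fun v => gX (fX v), fun v a => gD (fX v) (fD v a), ⟨?_, ?_, ?_, ?_, ?_⟩, ?_⟩
  · exact fun v hv w hw h => f1 hv hw (g1 (f2 v hv) (f2 w hw) h)
  · exact fun v hv => g2 _ (f2 v hv)
  · exact fun p hp => g3 _ (f3 p hp)
  · exact fun v a ha b hb h => f4 v ha hb (g4 (fX v) (f3 _ ha) (f3 _ hb) h)
  · intro p hp q hq h
    have h' := f5 p hp q hq h
    rw [← h']
    exact g5 _ (f3 p hp) _ (f3 q hq) (by rw [h']; exact h)
  · simp only [fv, gv]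

theorem EquivPat.embeds {P Q : QPattern} (h : P.EquivPat Q) : P.Embeds Q Q.vbar := by
  obtain ⟨fX, fD, hX, hA, hc, hv, -, -⟩ := h
  refine ⟨fX, fD, ⟨hX.injOn, fun v hv => hX.mapsTo hv, fun p hp => hA.mapsTo hp, ?_,
    fun p hp q hq _ => hc p hp q hq⟩, hv⟩
  intro v a ha b hb h
  have := hA.injOn (Finset.mem_coe.2 ha) (Finset.mem_coe.2 hb) (by simp [h])
  simpa using this

theorem SubPat.embeds {P Q : QPattern} (h : P.SubPat Q) : P.Embeds Q Q.vbar := by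
  obtain ⟨hX, hA, hc, hv, -, -⟩ := h
  exact ⟨id, fun _ a => a, ⟨fun _ _ _ _ h => h, fun v hv => hX hv, fun p hp => hA hp,
    fun _ _ _ _ _ h => h, fun p _ q _ h => (hc p q h).symm⟩, hv⟩

theorem Irreducible.eq_of_reducesTr {P R : QPattern} {tr : ℕ → ℕ} (hP : P.Irreducible)
    (h : ReducesTr P R tr) : R = P := by
  cases h with
  | refl => rfl
  | merge h _ => exact absurd h.1 (hP.1 _ _ _)
  | dangling h _ => exact absurd h.1 (hP.2 _)

theorem VarElimPattern.embeds {P Q : QPattern} {x : ℕ} (hP : P.VarElimPattern) (hflat : P.Flat)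
    (hirr : P.Irreducible) (hQ : Q.IsInstance) (hac : Q.ArcCons) (hx : x ∈ Q.X)
    (hs : ∃ s, Q.PartialSol (Q.X.erase x) s) (hns : ¬ ∃ s, Q.Sol s) : P.Embeds Q x := by
  by_contra hne
  have he : P.e = ∅ := hflat
  refine hns (hP Q hQ hac x hx ⟨id, by simp [he], by simp [he], ?_⟩ hs)
  rintro ⟨R, tr, hR, fX, fD, hf, hv, -⟩
  obtain rfl := hirr.eq_of_reducesTr hR
  exact hne ⟨fX, fD, hf, hv⟩

theorem varElimPattern_of_embeds {P T : QPattern} (hflat : P.Flat) (h : P.Embeds T T.vbar)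
    (hT : ∀ Q : QPattern, Q.IsInstance → Q.ArcCons → ∀ x ∈ Q.X, ¬ T.Embeds Q x →
      (∃ s, Q.PartialSol (Q.X.erase x) s) → ∃ s, Q.Sol s) : P.VarElimPattern := by
  rintro Q hQ hac x hx ⟨m, -, -, hm⟩ hs
  refine hT Q hQ hac x hx (fun hTQ => hm ?_) hs
  obtain ⟨fX, fD, hf, hv⟩ := h.trans hTQ
  have he : P.e = ∅ := hflat
  exact ⟨P, id, ReducesTr.refl P, fX, fD, hf, hv, by simp [he]⟩

theorem Flat.valbar_eq_none {P : QPattern} (h : P.Flat) : P.valbar = none := by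
  have he : P.e = ∅ := h
  cases hb : P.valbar with
  | none => rfl
  | some b => simpa [he] using P.valbar_mem b hb

theorem mem_of_cpt {P : QPattern} {p q : ℕ × ℕ} {b : Bool} (h : P.cpt p q = some b) :
    p ∈ P.A ∧ q ∈ P.A ∧ p.1 ≠ q.1 :=
  P.cpt_dom p q (by simp [h])

theorem exists_subPat_of_embeds {P T : QPattern} (hflat : P.Flat) (hirr : P.Irreducible)
    (h : P.Embeds T T.vbar) :
    ∃ S : QPattern, S.Flat ∧ S.Irreducible ∧ S.SubPat T ∧ P.EquivPat S ∧ S.Embeds P P.vbar := by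
  obtain ⟨fX, fD, ⟨f1, f2, f3, f4, f5⟩, fv⟩ := h
  have he : P.e = ∅ := hflat
  set F : ℕ × ℕ → ℕ × ℕ := fun p => (fX p.1, fD p.1 p.2) with hF
  have Finj : Set.InjOn F ↑P.A := by
    rintro ⟨v, a⟩ hp ⟨w, b⟩ hq h
    simp only [hF, Prod.mk.injEq] at h
    obtain rfl := f1 (P.A_sub _ hp) (P.A_sub _ hq) h.1
    obtain rfl := f4 v hp hq h.2
    rfl
  set G := Function.invFunOn F ↑P.A with hG
  have GF : ∀ p ∈ P.A, G (F p) = p := fun p hp => Finj.leftInvOn_invFunOn hp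
  have gX : ∀ v ∈ P.X, Function.invFunOn fX ↑P.X (fX v) = v :=
    fun v hv => f1.leftInvOn_invFunOn hv
  let S : QPattern :=
    { X := P.X.image fX
      A := P.A.image F
      cpt := fun p q => if p ∈ P.A.image F ∧ q ∈ P.A.image F then P.cpt (G p) (G q) else none
      cpt_symm := by
        intro p q
        simp only [and_comm, P.cpt_symm]
      cpt_dom := by
        intro p q h
        split_ifs at h with hpq
        · refine ⟨hpq.1, hpq.2, ?_⟩
          obtain ⟨⟨p, hp, rfl⟩, ⟨q, hq, rfl⟩⟩ :=
            And.intro (Finset.mem_image.1 hpq.1) (Finset.mem_image.1 hpq.2)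
          rw [GF p hp, GF q hq] at h
          intro heq
          exact (P.cpt_dom p q h).2.2 (f1 (P.A_sub _ hp) (P.A_sub _ hq) heq)
        · simp at h
      A_sub := by
        intro p hp'
        obtain ⟨p, hp, rfl⟩ := Finset.mem_image.1 hp'
        exact Finset.mem_image_of_mem _ (P.A_sub _ hp)
      dom_ne := by
        intro v hv'
        obtain ⟨v, hv, rfl⟩ := Finset.mem_image.1 hv'
        obtain ⟨a, ha⟩ := P.dom_ne v hv
        exact ⟨fD v a, Finset.mem_image_of_mem F ha⟩
      vbar := fX P.vbar
      vbar_mem := Finset.mem_image_of_mem _ P.vbar_mem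
      e := ∅
      e_sub := by simp
      valbar := none
      valbar_mem := by simp }
  have Sc : ∀ p ∈ P.A, ∀ q ∈ P.A, S.cpt (F p) (F q) = P.cpt p q := by
    intro p hp q hq
    have : S.cpt (F p) (F q) = P.cpt (G (F p)) (G (F q)) :=
      if_pos ⟨Finset.mem_image_of_mem F hp, Finset.mem_image_of_mem F hq⟩
    rw [this, GF p hp, GF q hq]
  have Sc' : ∀ p ∈ P.A, ∀ q, (P.cpt p q).isSome → S.cpt (F p) (F q) = P.cpt p q :=
    fun p hp q h => Sc p hp q (P.cpt_dom p q h).2.1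
  have hSA : ∀ p, p ∈ S.A ↔ ∃ q ∈ P.A, F q = p := fun p => Finset.mem_image
  refine ⟨S, rfl, ⟨?_, ?_⟩, ⟨?_, ?_, ?_, fv, by simp [S], by simp [S]⟩, ?_, ?_⟩
  · rintro v' a' b' ⟨ha, hb, hab, hc, -⟩
    obtain ⟨⟨v, a⟩, hp, hpe⟩ := (hSA _).1 ha
    obtain ⟨⟨w, b⟩, hq, hqe⟩ := (hSA _).1 hb
    obtain rfl : v = w := by
      refine f1 (P.A_sub _ hp) (P.A_sub _ hq) ?_
      have h1 := congrArg Prod.fst hpe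
      have h2 := congrArg Prod.fst hqe
      exact h1.trans h2.symm
    refine hirr.1 v a b ⟨hp, hq, ?_, ?_, by simp [he]⟩
    · rintro rfl
      have := hpe.symm.trans hqe
      simp at this
      exact hab this
    · intro r h1 h2
      have e1 := Sc' _ hp r h1
      have e2 := Sc' _ hq r h2
      rw [← e1, ← e2, hpe, hqe]
      apply hc
      · rw [← hpe, e1]; exact h1
      · rw [← hqe, e2]; exact h2
  · rintro p' ⟨hp', hu, ht, -⟩
    obtain ⟨p, hp, rfl⟩ := (hSA _).1 hp'
    refine hirr.2 p ⟨hp, ?_, ?_, by simp [he]⟩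
    · intro q r h1 h2
      refine Finj (P.cpt_dom _ _ h1).2.1 (P.cpt_dom _ _ h2).2.1 (hu _ _ ?_ ?_)
      · rw [Sc' p hp q h1]; exact h1
      · rw [Sc' p hp r h2]; exact h2
    · intro q h1
      rw [← Sc' p hp q h1]
      apply ht
      rw [Sc' p hp q h1]; exact h1
  · intro v hv'
    obtain ⟨v, hv, rfl⟩ := Finset.mem_image.1 hv'
    exact f2 v hv
  · intro p hp'
    obtain ⟨p, hp, rfl⟩ := (hSA _).1 hp'
    exact f3 p hp
  · intro p' q' h
    obtain ⟨hp', hq', -⟩ := S.cpt_dom _ _ h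
    obtain ⟨p, hp, rfl⟩ := (hSA _).1 hp'
    obtain ⟨q, hq, rfl⟩ := (hSA _).1 hq'
    rw [Sc p hp q hq] at h ⊢
    exact (f5 p hp q hq h).symm
  · refine ⟨fX, fD, ?_, ?_, Sc, rfl, by simp [S, he], by simp [S, hflat.valbar_eq_none]⟩
    · have := f1.bijOn_image
      simpa [S] using this
    · have := Finj.bijOn_image
      simpa [S] using this
  · refine ⟨Function.invFunOn fX ↑P.X, fun v a => (G (v, a)).2, ⟨?_, ?_, ?_, ?_, ?_⟩,
      gX _ P.vbar_mem⟩
    · intro v hv' w hw' h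
      obtain ⟨v, hv, rfl⟩ := Finset.mem_image.1 hv'
      obtain ⟨w, hw, rfl⟩ := Finset.mem_image.1 hw'
      rw [gX v hv, gX w hw] at h
      rw [h]
    · intro v hv'
      obtain ⟨v, hv, rfl⟩ := Finset.mem_image.1 hv'
      rw [gX v hv]; exact hv
    · intro p hp'
      obtain ⟨p, hp, rfl⟩ := (hSA _).1 hp'
      change (Function.invFunOn fX ↑P.X (fX p.1), (G (F p)).2) ∈ P.A
      rw [gX _ (P.A_sub _ hp), GF p hp]
      exact hp
    · intro v a ha b hb h
      obtain ⟨p, hp, hpe⟩ := (hSA _).1 ha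
      obtain ⟨q, hq, hqe⟩ := (hSA _).1 hb
      simp only [← hpe, ← hqe, GF p hp, GF q hq] at h
      have h1 := congrArg Prod.fst hpe
      have h2 := congrArg Prod.fst hqe
      have h3 : p.1 = q.1 := f1 (P.A_sub _ hp) (P.A_sub _ hq) (h1.trans h2.symm)
      have : p = q := Prod.ext h3 h
      have h4 := hpe.symm.trans (this ▸ hqe)
      simpa using h4
    · intro p hp' q hq' _
      obtain ⟨p, hp, rfl⟩ := (hSA _).1 hp'
      obtain ⟨q, hq, rfl⟩ := (hSA _).1 hq'
      rw [Sc p hp q hq]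
      change P.cpt (Function.invFunOn fX ↑P.X (fX p.1), (G (F p)).2)
        (Function.invFunOn fX ↑P.X (fX q.1), (G (F q)).2) = _
      rw [gX _ (P.A_sub _ hp), gX _ (P.A_sub _ hq), GF p hp, GF q hq]

end QPattern

namespace QPattern

theorem IsInstance.eq_false {Q : QPattern} (hQ : Q.IsInstance) {p q : ℕ × ℕ} (hp : p ∈ Q.A)
    (hq : q ∈ Q.A) (hne : p.1 ≠ q.1) (h : Q.cpt p q ≠ some true) : Q.cpt p q = some false := by
  obtain ⟨b, hb⟩ := Option.isSome_iff_exists.1 (hQ p hp q hq hne)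
  cases b <;> simp_all

theorem exists_sol_of_extension {Q : QPattern} {x c : ℕ} {s : ℕ → ℕ}
    (hsA : ∀ v ∈ Q.X.erase x, (v, s v) ∈ Q.A)
    (hs : ∀ v ∈ Q.X.erase x, ∀ w ∈ Q.X.erase x, v ≠ w →
      Q.cpt (v, s v) (w, s w) = some true)
    (hcA : (x, c) ∈ Q.A) (hc : ∀ v ∈ Q.X.erase x, Q.cpt (v, s v) (x, c) = some true) :
    ∃ s, Q.Sol s := by
  refine ⟨Function.update s x c, ?_, ?_⟩
  · intro v hv
    by_cases hvx : v = x
    · subst hvx; simpa using hcA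
    · simpa [hvx] using hsA v (Finset.mem_erase.2 ⟨hvx, hv⟩)
  · intro v hv w hw hvw
    by_cases hvx : v = x
    · subst hvx
      rw [Q.cpt_symm]
      simpa [hvw.symm] using hc w (Finset.mem_erase.2 ⟨hvw.symm, hw⟩)
    · by_cases hwx : w = x
      · subst hwx
        simpa [hvx] using hc v (Finset.mem_erase.2 ⟨hvx, hv⟩)
      · simpa [hvx, hwx] using
          hs v (Finset.mem_erase.2 ⟨hvx, hv⟩) w (Finset.mem_erase.2 ⟨hwx, hw⟩) hvw

theorem embeds_BTPpat {Q : QPattern} {p q : ℕ × ℕ} {x c d : ℕ}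
    (hpq : Q.cpt p q = some true) (hpc : Q.cpt p (x, c) = some true)
    (hqd : Q.cpt q (x, d) = some true) (hpd : Q.cpt p (x, d) = some false)
    (hqc : Q.cpt q (x, c) = some false) : BTPpat.Embeds Q x := by
  obtain ⟨hp, hq, n1⟩ := mem_of_cpt hpq
  obtain ⟨-, hc, n2⟩ := mem_of_cpt hpc
  obtain ⟨-, hd, n3⟩ := mem_of_cpt hqd
  have hcd : c ≠ d := by rintro rfl; simp [hpc] at hpd
  refine ⟨fun v => if v = 0 then p.1 else if v = 1 then q.1 else x,
    fun v a => if v = 0 then p.2 else if v = 1 then q.2 else if a = 0 then c else d,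
    ⟨?_, ?_, ?_, ?_, ?_⟩, rfl⟩
  · intro v hv w hw
    simp only [BTPpat, Finset.coe_insert, Finset.coe_singleton, Set.mem_insert_iff,
      Set.mem_singleton_iff] at hv hw
    rcases hv with rfl | rfl | rfl <;> rcases hw with rfl | rfl | rfl <;> simp_all [eq_comm]
  · intro v hv
    simp only [BTPpat, Finset.mem_insert, Finset.mem_singleton] at hv
    rcases hv with rfl | rfl | rfl
    exacts [Q.A_sub _ hp, Q.A_sub _ hq, Q.A_sub _ hc]
  · intro r hr
    simp only [BTPpat, Finset.mem_insert, Finset.mem_singleton] at hr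
    rcases hr with rfl | rfl | rfl | rfl
    exacts [hp, hq, hc, hd]
  · intro v a ha b hb h
    simp only [BTPpat, Finset.mem_insert, Finset.mem_singleton, Set.mem_ofPred_eq,
      Prod.mk.injEq] at ha hb
    rcases ha with ⟨rfl, rfl⟩ | ⟨rfl, rfl⟩ | ⟨rfl, rfl⟩ | ⟨rfl, rfl⟩ <;> simp_all
    rcases hb with rfl | rfl <;> simp_all
  · intro a ha b hb h
    simp only [BTPpat, Finset.mem_insert, Finset.mem_singleton] at ha hb
    rcases ha with rfl | rfl | rfl | rfl <;> rcases hb with rfl | rfl | rfl | rfl <;>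
      first
      | (exfalso; revert h; decide)
      | exact hpq
      | exact (Q.cpt_symm _ _).trans hpq
      | exact hpc
      | exact (Q.cpt_symm _ _).trans hpc
      | exact hqd
      | exact (Q.cpt_symm _ _).trans hqd
      | exact hpd
      | exact (Q.cpt_symm _ _).trans hpd
      | exact hqc
      | exact (Q.cpt_symm _ _).trans hqc

theorem embeds_invsubBTPpat {Q : QPattern} {u : ℕ × ℕ} {x d y s t : ℕ}
    (hsd : Q.cpt (y, s) (x, d) = some false) (htd : Q.cpt (y, t) (x, d) = some true)
    (hud : Q.cpt u (x, d) = some true) (htu : Q.cpt (y, t) u = some false) :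
    invsubBTPpat.Embeds Q x := by
  obtain ⟨hs, hd, n1⟩ := mem_of_cpt hsd
  obtain ⟨ht, hu, n2⟩ := mem_of_cpt htu
  obtain ⟨-, -, n3⟩ := mem_of_cpt hud
  have hst : s ≠ t := by rintro rfl; simp [hsd] at htd
  refine ⟨fun v => if v = 0 then y else if v = 1 then u.1 else x,
    fun v a => if v = 0 then (if a = 0 then s else t) else if v = 1 then u.2 else d,
    ⟨?_, ?_, ?_, ?_, ?_⟩, rfl⟩
  · intro v hv w hw
    simp only [invsubBTPpat, Finset.coe_insert, Finset.coe_singleton, Set.mem_insert_iff,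
      Set.mem_singleton_iff] at hv hw
    rcases hv with rfl | rfl | rfl <;> rcases hw with rfl | rfl | rfl <;> simp_all [eq_comm]
  · intro v hv
    simp only [invsubBTPpat, Finset.mem_insert, Finset.mem_singleton] at hv
    rcases hv with rfl | rfl | rfl
    exacts [Q.A_sub _ hs, Q.A_sub _ hu, Q.A_sub _ hd]
  · intro r hr
    simp only [invsubBTPpat, Finset.mem_insert, Finset.mem_singleton] at hr
    rcases hr with rfl | rfl | rfl | rfl
    exacts [hs, ht, hu, hd]
  · intro v a ha b hb h
    simp only [invsubBTPpat, Finset.mem_insert, Finset.mem_singleton, Set.mem_ofPred_eq,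
      Prod.mk.injEq] at ha hb
    rcases ha with ⟨rfl, rfl⟩ | ⟨rfl, rfl⟩ | ⟨rfl, rfl⟩ | ⟨rfl, rfl⟩ <;> simp_all
    rcases hb with rfl | rfl <;> simp_all
  · intro a ha b hb h
    simp only [invsubBTPpat, Finset.mem_insert, Finset.mem_singleton] at ha hb
    rcases ha with rfl | rfl | rfl | rfl <;> rcases hb with rfl | rfl | rfl | rfl <;>
      first
      | (exfalso; revert h; decide)
      | exact hsd
      | exact (Q.cpt_symm _ _).trans hsd
      | exact htd
      | exact (Q.cpt_symm _ _).trans htd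
      | exact hud
      | exact (Q.cpt_symm _ _).trans hud
      | exact htu
      | exact (Q.cpt_symm _ _).trans htu

theorem embeds_snakePat {Q : QPattern} {u : ℕ × ℕ} {x d y s t : ℕ} (hux : u.1 ≠ x)
    (hsd : Q.cpt (y, s) (x, d) = some false) (htd : Q.cpt (y, t) (x, d) = some true)
    (hsu : Q.cpt (y, s) u = some true) (htu : Q.cpt (y, t) u = some false) :
    snakePat.Embeds Q x := by
  obtain ⟨hs, hd, n1⟩ := mem_of_cpt hsd
  obtain ⟨ht, hu, n2⟩ := mem_of_cpt htu
  have hst : s ≠ t := by rintro rfl; simp [hsd] at htd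
  refine ⟨fun v => if v = 0 then y else if v = 1 then u.1 else x,
    fun v a => if v = 0 then (if a = 0 then s else t) else if v = 1 then u.2 else d,
    ⟨?_, ?_, ?_, ?_, ?_⟩, rfl⟩
  · intro v hv w hw
    simp only [snakePat, Finset.coe_insert, Finset.coe_singleton, Set.mem_insert_iff,
      Set.mem_singleton_iff] at hv hw
    rcases hv with rfl | rfl | rfl <;> rcases hw with rfl | rfl | rfl <;> simp_all [eq_comm]
  · intro v hv
    simp only [snakePat, Finset.mem_insert, Finset.mem_singleton] at hv
    rcases hv with rfl | rfl | rfl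
    exacts [Q.A_sub _ hs, Q.A_sub _ hu, Q.A_sub _ hd]
  · intro r hr
    simp only [snakePat, Finset.mem_insert, Finset.mem_singleton] at hr
    rcases hr with rfl | rfl | rfl | rfl
    exacts [hs, ht, hu, hd]
  · intro v a ha b hb h
    simp only [snakePat, Finset.mem_insert, Finset.mem_singleton, Set.mem_ofPred_eq,
      Prod.mk.injEq] at ha hb
    rcases ha with ⟨rfl, rfl⟩ | ⟨rfl, rfl⟩ | ⟨rfl, rfl⟩ | ⟨rfl, rfl⟩ <;> simp_all
    rcases hb with rfl | rfl <;> simp_all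
  · intro a ha b hb h
    simp only [snakePat, Finset.mem_insert, Finset.mem_singleton] at ha hb
    rcases ha with rfl | rfl | rfl | rfl <;> rcases hb with rfl | rfl | rfl | rfl <;>
      first
      | (exfalso; revert h; decide)
      | exact hsd
      | exact (Q.cpt_symm _ _).trans hsd
      | exact htd
      | exact (Q.cpt_symm _ _).trans htd
      | exact hsu
      | exact (Q.cpt_symm _ _).trans hsu
      | exact htu
      | exact (Q.cpt_symm _ _).trans htu

theorem exists_sol_of_not_embeds_BTPpat {Q : QPattern} (hQ : Q.IsInstance) (hac : Q.ArcCons)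
    {x : ℕ} (hx : x ∈ Q.X) (hT : ¬ BTPpat.Embeds Q x)
    (hs : ∃ s, Q.PartialSol (Q.X.erase x) s) : ∃ s, Q.Sol s := by
  classical
  obtain ⟨s, hsA, hs⟩ := hs
  set D : ℕ → Finset (ℕ × ℕ) := fun v =>
    Q.A.filter fun c => c.1 = x ∧ Q.cpt (v, s v) c = some true with hD
  have hDne : ∀ v ∈ Q.X.erase x, (D v).Nonempty := by
    intro v hv
    obtain ⟨b, hb, hc⟩ := hac _ (hsA v hv) x hx (Finset.ne_of_mem_erase hv).symm
    exact ⟨(x, b), by simp [hD, hb, hc]⟩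
  have key : ∃ c, (x, c) ∈ Q.A ∧ ∀ v ∈ Q.X.erase x, Q.cpt (v, s v) (x, c) = some true := by
    rcases (Q.X.erase x).eq_empty_or_nonempty with h0 | hne
    · obtain ⟨c, hc⟩ := Q.dom_ne x hx
      exact ⟨c, hc, by simp [h0]⟩
    · obtain ⟨y, hy, hmin⟩ := Finset.exists_min_image _ (fun v => (D v).card) hne
      obtain ⟨⟨x', c⟩, hc⟩ := hDne y hy
      obtain ⟨hcA, hx', hyc⟩ := Finset.mem_filter.1 hc
      obtain rfl : x' = x := hx'
      refine ⟨c, hcA, fun z hz => ?_⟩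
      by_contra hzc
      have hnsub : ¬ D z ⊆ D y := by
        intro hsub
        have heq := Finset.eq_of_subset_of_card_le hsub (hmin z hz)
        rw [← heq] at hc
        exact hzc (Finset.mem_filter.1 hc).2.2
      obtain ⟨⟨x'', d⟩, hdz, hdy⟩ := Finset.not_subset.1 hnsub
      obtain ⟨hdA, hx'', hzd⟩ := Finset.mem_filter.1 hdz
      obtain rfl : x'' = x' := hx''
      have hyd : Q.cpt (y, s y) (x'', d) ≠ some true := fun h =>
        hdy (Finset.mem_filter.2 ⟨hdA, rfl, h⟩)
      have hyz : y ≠ z := by rintro rfl; exact hyd hzd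
      exact hT (embeds_BTPpat (hs y hy z hz hyz) hyc hzd
        (hQ.eq_false (hsA y hy) hdA (Finset.ne_of_mem_erase hy) hyd)
        (hQ.eq_false (hsA z hz) hcA (Finset.ne_of_mem_erase hz) hzc))
  obtain ⟨c, hcA, hc⟩ := key
  exact exists_sol_of_extension hsA hs hcA hc

theorem exists_sol_of_not_embeds_invsubBTPpat {Q : QPattern} (hQ : Q.IsInstance)
    (hac : Q.ArcCons) {x : ℕ} (hx : x ∈ Q.X) (hT : ¬ invsubBTPpat.Embeds Q x)
    (hs : ∃ s, Q.PartialSol (Q.X.erase x) s) : ∃ s, Q.Sol s := by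
  classical
  obtain ⟨s, hsA, hs⟩ := hs
  obtain ⟨d, hd⟩ := Q.dom_ne x hx
  have hex : ∀ v, ∃ b, v ∈ Q.X.erase x →
      (v, b) ∈ Q.A ∧ Q.cpt (v, b) (x, d) = some true ∧
        (Q.cpt (v, s v) (x, d) = some true → b = s v) := by
    intro v
    by_cases hv : v ∈ Q.X.erase x
    · by_cases h : Q.cpt (v, s v) (x, d) = some true
      · exact ⟨s v, fun _ => ⟨hsA v hv, h, fun _ => rfl⟩⟩
      · obtain ⟨b, hb, hc⟩ := hac _ hd v (Finset.mem_of_mem_erase hv) (Finset.ne_of_mem_erase hv)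
        exact ⟨b, fun _ => ⟨hb, (Q.cpt_symm _ _).trans hc, fun h' => absurd h' h⟩⟩
    · exact ⟨0, fun h => absurd h hv⟩
  choose t ht using hex
  have main : ∀ v ∈ Q.X.erase x, ∀ w ∈ Q.X.erase x, v ≠ w →
      Q.cpt (v, s v) (x, d) ≠ some true → Q.cpt (v, t v) (w, t w) = some true := by
    intro v hv w hw hvw h
    by_contra hc
    exact hT (embeds_invsubBTPpat (hQ.eq_false (hsA v hv) hd (Finset.ne_of_mem_erase hv) h)
      (ht v hv).2.1 (ht w hw).2.1 (hQ.eq_false (ht v hv).1 (ht w hw).1 hvw hc))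
  refine exists_sol_of_extension (s := t) (fun v hv => (ht v hv).1) ?_ hd
    (fun v hv => (ht v hv).2.1)
  intro v hv w hw hvw
  by_cases h1 : Q.cpt (v, s v) (x, d) = some true
  · by_cases h2 : Q.cpt (w, s w) (x, d) = some true
    · rw [(ht v hv).2.2 h1, (ht w hw).2.2 h2]
      exact hs v hv w hw hvw
    · rw [Q.cpt_symm]
      exact main w hw v hv hvw.symm h2
  · exact main v hv w hw hvw h1

theorem exists_sol_of_not_embeds_snakePat {Q : QPattern} (hQ : Q.IsInstance) (hac : Q.ArcCons)
    {x : ℕ} (hx : x ∈ Q.X) (hT : ¬ snakePat.Embeds Q x)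
    (hs : ∃ s, Q.PartialSol (Q.X.erase x) s) : ∃ s, Q.Sol s := by
  classical
  obtain ⟨d, hd⟩ := Q.dom_ne x hx
  have key : ∃ s, Q.PartialSol (Q.X.erase x) s ∧
      ∀ v ∈ Q.X.erase x, Q.cpt (v, s v) (x, d) = some true := by
    have step : ∀ Y ⊆ Q.X.erase x, ∃ s, Q.PartialSol (Q.X.erase x) s ∧
        ∀ v ∈ Y, Q.cpt (v, s v) (x, d) = some true := by
      intro Y
      induction Y using Finset.induction_on with
      | empty => exact fun _ => hs.imp fun s h => ⟨h, by simp⟩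
      | insert y Y hyY ih =>
        intro hY
        obtain ⟨s, ⟨hsA, hs⟩, hsY⟩ := ih fun v hv => hY (Finset.mem_insert_of_mem hv)
        have hy := hY (Finset.mem_insert_self y Y)
        by_cases h : Q.cpt (y, s y) (x, d) = some true
        · exact ⟨s, ⟨hsA, hs⟩, fun v hv =>
            (Finset.mem_insert.1 hv).elim (fun e => e ▸ h) (hsY v)⟩
        obtain ⟨t, htA, htc⟩ :=
          hac _ hd y (Finset.mem_of_mem_erase hy) (Finset.ne_of_mem_erase hy)
        rw [Q.cpt_symm] at htc
        have ht : ∀ w ∈ Q.X.erase x, y ≠ w → Q.cpt (y, t) (w, s w) = some true := by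
          intro w hw hyw
          by_contra hc
          exact hT (embeds_snakePat (Finset.ne_of_mem_erase hw)
            (hQ.eq_false (hsA y hy) hd (Finset.ne_of_mem_erase hy) h) htc
            (hs y hy w hw hyw) (hQ.eq_false htA (hsA w hw) hyw hc))
        refine ⟨Function.update s y t, ⟨?_, ?_⟩, ?_⟩
        · intro v hv
          by_cases hvy : v = y
          · subst hvy; simpa using htA
          · simpa [hvy] using hsA v hv
        · intro v hv w hw hvw
          by_cases hvy : v = y
          · subst hvy
            simpa [hvw.symm] using ht w hw hvw
          · by_cases hwy : w = y
            · subst hwy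
              rw [Q.cpt_symm]
              simpa [hvy] using ht v hv hvw.symm
            · simpa [hvy, hwy] using hs v hv w hw hvw
        · intro v hv
          by_cases hvy : v = y
          · subst hvy; simpa using htc
          · simpa [hvy] using hsY v (Finset.mem_of_mem_insert_of_ne hv hvy)
    exact step _ subset_rfl
  obtain ⟨s, ⟨hsA, hs⟩, hc⟩ := key
  exact exists_sol_of_extension hsA hs hd hc

end QPattern

namespace QPattern

/-- `P.NoVee x`: no value of a variable other than `x` is incompatible both with a value of `x` and
with a value of a third variable. -/
def NoVee (P : QPattern) (x : ℕ) : Prop :=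
  ∀ c ∈ P.A, c.1 = x →
    ∀ q ∈ P.A, P.cpt q c = some false →
    ∀ p ∈ P.A, p.1 ≠ x → P.cpt p q = some false → False

instance (P : QPattern) (x : ℕ) : Decidable (P.NoVee x) := by
  unfold NoVee; infer_instance

/-- `P.NoApex x`: no value of `x` is incompatible with values of two different variables. -/
def NoApex (P : QPattern) (x : ℕ) : Prop :=
  ∀ c ∈ P.A, c.1 = x →
    ∀ p ∈ P.A, P.cpt p c = some false →
    ∀ q ∈ P.A, p.1 ≠ q.1 → P.cpt q c = some false → False

instance (P : QPattern) (x : ℕ) : Decidable (P.NoApex x) := by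
  unfold NoApex; infer_instance

/-- `P.NoZigzag x`: no two values of a variable and two values of `x` induce a negative, a positive
and a negative edge in a row. -/
def NoZigzag (P : QPattern) (x : ℕ) : Prop :=
  ∀ c₀ ∈ P.A, c₀.1 = x →
    ∀ q₀ ∈ P.A, P.cpt q₀ c₀ = some false →
    ∀ q₁ ∈ P.A, q₁.1 = q₀.1 → P.cpt q₁ c₀ = some true →
    ∀ c₁ ∈ P.A, c₁.1 = x → P.cpt q₁ c₁ = some false → False

set_option synthInstance.maxSize 1000 in
set_option synthInstance.maxHeartbeats 200000 in
instance (P : QPattern) (x : ℕ) : Decidable (P.NoZigzag x) := by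
  unfold NoZigzag; infer_instance

/-- `P.NoHook x`: absence of the edges `y₀z₀ = F`, `y₀z₁ = T`, `y₀x₁ = T`, `z₁x₁ = F`. -/
def NoHook (P : QPattern) (x : ℕ) : Prop :=
  ∀ c ∈ P.A, c.1 = x →
    ∀ q₁ ∈ P.A, P.cpt q₁ c = some false →
    ∀ p ∈ P.A, P.cpt p c = some true → P.cpt p q₁ = some true →
    ∀ q₀ ∈ P.A, q₀.1 = q₁.1 → P.cpt p q₀ = some false → False

instance (P : QPattern) (x : ℕ) : Decidable (P.NoHook x) := by
  unfold NoHook; infer_instance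

/-- `P.NoFork x`: absence of the edges `y₀z₀ = F`, `y₁z₀ = T`, `y₁z₁ = F`, `y₁x₁ = T`, `z₁x₁ = T`.
-/
def NoFork (P : QPattern) (x : ℕ) : Prop :=
  ∀ c ∈ P.A, c.1 = x →
    ∀ q₁ ∈ P.A, P.cpt q₁ c = some true →
    ∀ p₁ ∈ P.A, P.cpt p₁ c = some true → P.cpt p₁ q₁ = some false →
    ∀ q₀ ∈ P.A, q₀.1 = q₁.1 → P.cpt p₁ q₀ = some true →
    ∀ p₀ ∈ P.A, p₀.1 = p₁.1 → P.cpt p₀ q₀ = some false → False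

set_option synthInstance.maxSize 1000 in
set_option synthInstance.maxHeartbeats 200000 in
instance (P : QPattern) (x : ℕ) : Decidable (P.NoFork x) := by
  unfold NoFork; infer_instance

/-- `P.NoKite x`: absence of the edges `y₀z₀ = F`, `y₀z₁ = T`, `y₁z₀ = T`, `y₁x₁ = T`, `z₁x₁ = T`.
-/
def NoKite (P : QPattern) (x : ℕ) : Prop :=
  ∀ c ∈ P.A, c.1 = x →
    ∀ q₁ ∈ P.A, P.cpt q₁ c = some true →
    ∀ p₁ ∈ P.A, P.cpt p₁ c = some true →
    ∀ p₀ ∈ P.A, p₀.1 = p₁.1 → P.cpt p₀ q₁ = some true →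
    ∀ q₀ ∈ P.A, q₀.1 = q₁.1 → P.cpt p₁ q₀ = some true → P.cpt p₀ q₀ = some false → False

instance (P : QPattern) (x : ℕ) : Decidable (P.NoKite x) := by
  unfold NoKite; infer_instance

/-- `P.NoCycle x`: absence of the edges `y₁z₀ = T`, `y₁x₀ = T`, `z₀x₁ = T`, `z₁x₀ = T`, `z₁x₁ = F`.
-/
def NoCycle (P : QPattern) (x : ℕ) : Prop :=
  ∀ c₁ ∈ P.A, c₁.1 = x →
    ∀ q₁ ∈ P.A, P.cpt q₁ c₁ = some false →
    ∀ c₀ ∈ P.A, c₀.1 = x → P.cpt q₁ c₀ = some true →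
    ∀ q₀ ∈ P.A, q₀.1 = q₁.1 → P.cpt q₀ c₁ = some true →
    ∀ p ∈ P.A, P.cpt p c₀ = some true → P.cpt p q₀ = some true → False

instance (P : QPattern) (x : ℕ) : Decidable (P.NoCycle x) := by
  unfold NoCycle; infer_instance

theorem IsEmbedding.transfer {P Q : QPattern} {fX : ℕ → ℕ} {fD : ℕ → ℕ → ℕ}
    (h : IsEmbedding P Q fX fD) : ∃ f : ℕ × ℕ → ℕ × ℕ,
      (∀ p, (f p).1 = fX p.1) ∧ (∀ p ∈ P.A, f p ∈ Q.A) ∧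
      ∀ p q b, P.cpt p q = some b → Q.cpt (f p) (f q) = some b := by
  refine ⟨fun p => (fX p.1, fD p.1 p.2), fun p => rfl, h.2.2.1, fun p q b hb => ?_⟩
  obtain ⟨hp, hq, -⟩ := mem_of_cpt hb
  rw [h.2.2.2.2 p hp q hq (by simp [hb]), hb]

theorem NoVee.of_embeds {P Q : QPattern} {x : ℕ} (hQ : Q.NoVee x) (h : P.Embeds Q x) :
    P.NoVee P.vbar := by
  obtain ⟨fX, fD, hf, rfl⟩ := h
  obtain ⟨f, f1, fm, fc⟩ := hf.transfer
  intro c hc h1 q hq h2 p hp h3 h4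
  exact hQ (f c) (fm c hc) (by rw [f1, h1]) (f q) (fm q hq) (fc _ _ _ h2) (f p) (fm p hp) (fun
    e => h3 (hf.1 (P.A_sub _ hp) P.vbar_mem (by rw [← f1, e]))) (fc _ _ _ h4)

theorem NoApex.of_embeds {P Q : QPattern} {x : ℕ} (hQ : Q.NoApex x) (h : P.Embeds Q x) :
    P.NoApex P.vbar := by
  obtain ⟨fX, fD, hf, rfl⟩ := h
  obtain ⟨f, f1, fm, fc⟩ := hf.transfer
  intro c hc h1 p hp h2 q hq h3 h4
  exact hQ (f c) (fm c hc) (by rw [f1, h1]) (f p) (fm p hp) (fc _ _ _ h2) (f q) (fm q hq) (fun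
    e => h3 (hf.1 (P.A_sub _ hp) (P.A_sub _ hq) (by rw [← f1, ← f1, e]))) (fc _ _ _ h4)

theorem NoZigzag.of_embeds {P Q : QPattern} {x : ℕ} (hQ : Q.NoZigzag x) (h : P.Embeds Q x) :
    P.NoZigzag P.vbar := by
  obtain ⟨fX, fD, hf, rfl⟩ := h
  obtain ⟨f, f1, fm, fc⟩ := hf.transfer
  intro c₀ hc₀ h1 q₀ hq₀ h2 q₁ hq₁ h3 h4 c₁ hc₁ h5 h6
  exact hQ (f c₀) (fm c₀ hc₀) (by rw [f1, h1]) (f q₀) (fm q₀ hq₀) (fc _ _ _ h2) (f q₁) (fm q₁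
    hq₁) (by rw [f1, f1, h3]) (fc _ _ _ h4) (f c₁) (fm c₁ hc₁) (by rw [f1, h5]) (fc _ _ _ h6)

theorem NoHook.of_embeds {P Q : QPattern} {x : ℕ} (hQ : Q.NoHook x) (h : P.Embeds Q x) :
    P.NoHook P.vbar := by
  obtain ⟨fX, fD, hf, rfl⟩ := h
  obtain ⟨f, f1, fm, fc⟩ := hf.transfer
  intro c hc h1 q₁ hq₁ h2 p hp h3 h4 q₀ hq₀ h5 h6
  exact hQ (f c) (fm c hc) (by rw [f1, h1]) (f q₁) (fm q₁ hq₁) (fc _ _ _ h2) (f p) (fm p hp)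
    (fc _ _ _ h3) (fc _ _ _ h4) (f q₀) (fm q₀ hq₀) (by rw [f1, f1, h5]) (fc _ _ _ h6)

theorem NoFork.of_embeds {P Q : QPattern} {x : ℕ} (hQ : Q.NoFork x) (h : P.Embeds Q x) :
    P.NoFork P.vbar := by
  obtain ⟨fX, fD, hf, rfl⟩ := h
  obtain ⟨f, f1, fm, fc⟩ := hf.transfer
  intro c hc h1 q₁ hq₁ h2 p₁ hp₁ h3 h4 q₀ hq₀ h5 h6 p₀ hp₀ h7 h8
  exact hQ (f c) (fm c hc) (by rw [f1, h1]) (f q₁) (fm q₁ hq₁) (fc _ _ _ h2) (f p₁) (fm p₁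
    hp₁) (fc _ _ _ h3) (fc _ _ _ h4) (f q₀) (fm q₀ hq₀) (by rw [f1, f1, h5]) (fc _ _ _ h6) (f
    p₀) (fm p₀ hp₀) (by rw [f1, f1, h7]) (fc _ _ _ h8)

theorem NoKite.of_embeds {P Q : QPattern} {x : ℕ} (hQ : Q.NoKite x) (h : P.Embeds Q x) :
    P.NoKite P.vbar := by
  obtain ⟨fX, fD, hf, rfl⟩ := h
  obtain ⟨f, f1, fm, fc⟩ := hf.transfer
  intro c hc h1 q₁ hq₁ h2 p₁ hp₁ h3 p₀ hp₀ h4 h5 q₀ hq₀ h6 h7 h8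
  exact hQ (f c) (fm c hc) (by rw [f1, h1]) (f q₁) (fm q₁ hq₁) (fc _ _ _ h2) (f p₁) (fm p₁
    hp₁) (fc _ _ _ h3) (f p₀) (fm p₀ hp₀) (by rw [f1, f1, h4]) (fc _ _ _ h5) (f q₀) (fm q₀ hq₀)
    (by rw [f1, f1, h6]) (fc _ _ _ h7) (fc _ _ _ h8)

theorem NoCycle.of_embeds {P Q : QPattern} {x : ℕ} (hQ : Q.NoCycle x) (h : P.Embeds Q x) :
    P.NoCycle P.vbar := by
  obtain ⟨fX, fD, hf, rfl⟩ := h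
  obtain ⟨f, f1, fm, fc⟩ := hf.transfer
  intro c₁ hc₁ h1 q₁ hq₁ h2 c₀ hc₀ h3 h4 q₀ hq₀ h5 h6 p hp h7 h8
  exact hQ (f c₁) (fm c₁ hc₁) (by rw [f1, h1]) (f q₁) (fm q₁ hq₁) (fc _ _ _ h2) (f c₀) (fm c₀
    hc₀) (by rw [f1, h3]) (fc _ _ _ h4) (f q₀) (fm q₀ hq₀) (by rw [f1, f1, h5]) (fc _ _ _ h6) (f
    p) (fm p hp) (fc _ _ _ h7) (fc _ _ _ h8)

/-- The binary CSP instance with variables `0, …, n - 1`, domains `{0, …, dom v - 1}` and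
compatibility of `⟨v, a⟩` and `⟨w, b⟩`, for `v < w`, given by `r v a w b`. -/
def instanceOf (n x : ℕ) (hx : x < n) (dom : ℕ → ℕ) (hdom : ∀ v < n, 0 < dom v)
    (r : ℕ → ℕ → ℕ → ℕ → Bool) : QPattern where
  X := Finset.range n
  A := (Finset.range n).biUnion fun v => (Finset.range (dom v)).image (Prod.mk v)
  cpt p q :=
    if (p.1 < n ∧ p.2 < dom p.1) ∧ (q.1 < n ∧ q.2 < dom q.1) ∧ p.1 ≠ q.1 then
      some (if p.1 < q.1 then r p.1 p.2 q.1 q.2 else r q.1 q.2 p.1 p.2)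
    else none
  cpt_symm p q := by
    by_cases h : p.1 = q.1
    · simp [h]
    · refine if_congr (by rw [and_left_comm, ne_comm]) ?_ rfl
      rcases lt_or_gt_of_ne h with h' | h' <;> simp [h', h'.not_gt]
  cpt_dom p q h := by
    by_cases hpq : (p.1 < n ∧ p.2 < dom p.1) ∧ (q.1 < n ∧ q.2 < dom q.1) ∧ p.1 ≠ q.1
    · obtain ⟨⟨h1, h2⟩, ⟨h3, h4⟩, h5⟩ := hpq
      refine ⟨?_, ?_, h5⟩ <;> simp only [Finset.mem_biUnion, Finset.mem_range, Finset.mem_image]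
      exacts [⟨p.1, h1, p.2, h2, rfl⟩, ⟨q.1, h3, q.2, h4, rfl⟩]
    · rw [if_neg hpq] at h
      simp at h
  A_sub p hp := by
    simp only [Finset.mem_biUnion, Finset.mem_range, Finset.mem_image] at hp ⊢
    obtain ⟨v, hv, a, -, rfl⟩ := hp
    exact hv
  dom_ne v hv := by
    simp only [Finset.mem_biUnion, Finset.mem_range, Finset.mem_image] at hv ⊢
    exact ⟨0, v, hv, 0, hdom v hv, rfl⟩
  vbar := x
  vbar_mem := Finset.mem_range.2 hx
  e := ∅
  e_sub := by simp
  valbar := none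
  valbar_mem := by simp

section instanceOf

variable {n x : ℕ} {hx : x < n} {dom : ℕ → ℕ} {hdom : ∀ v < n, 0 < dom v}
  {r : ℕ → ℕ → ℕ → ℕ → Bool}

theorem mem_instanceOf {p : ℕ × ℕ} :
    p ∈ (instanceOf n x hx dom hdom r).A ↔ p.1 < n ∧ p.2 < dom p.1 := by
  simp only [instanceOf, Finset.mem_biUnion, Finset.mem_range, Finset.mem_image]
  constructor
  · rintro ⟨v, hv, a, ha, rfl⟩
    exact ⟨hv, ha⟩
  · exact fun h => ⟨p.1, h.1, p.2, h.2, rfl⟩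

theorem isInstance_instanceOf : (instanceOf n x hx dom hdom r).IsInstance := by
  intro p hp q hq hpq
  rw [mem_instanceOf] at hp hq
  simp [instanceOf, hp, hq, hpq]

theorem Sol.instanceOf {s : ℕ → ℕ} (h : (instanceOf n x hx dom hdom r).Sol s) :
    (∀ v < n, s v < dom v) ∧ ∀ v < n, ∀ w < n, v < w → r v (s v) w (s w) = true := by
  obtain ⟨h1, h2⟩ := h
  have h1' : ∀ v < n, s v < dom v := fun v hv =>
    (mem_instanceOf.1 (h1 v (Finset.mem_range.2 hv))).2
  refine ⟨h1', fun v hv w hw hvw => ?_⟩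
  have := h2 v (Finset.mem_range.2 hv) w (Finset.mem_range.2 hw) hvw.ne
  simpa [QPattern.instanceOf, hv, hw, h1' v hv, h1' w hw, hvw.ne, hvw] using this

theorem VarElimPattern.embeds_instanceOf {P : QPattern} (hP : P.VarElimPattern) (hflat : P.Flat)
    (hirr : P.Irreducible)
    (hac : ∀ v < n, ∀ a < dom v, ∀ w < n, w ≠ v → ∃ b < dom w,
      (if v < w then r v a w b else r w b v a) = true)
    (s : ℕ → ℕ) (hs : ∀ v < n, v ≠ x → s v < dom v)
    (hs' : ∀ v < n, ∀ w < n, v ≠ x → w ≠ x → v < w → r v (s v) w (s w) = true)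
    (hns : ∀ s : ℕ → ℕ, (∀ v < n, s v < dom v) →
      (∀ v < n, ∀ w < n, v < w → r v (s v) w (s w) = true) → False) :
    P.Embeds (instanceOf n x hx dom hdom r) x := by
  refine hP.embeds hflat hirr isInstance_instanceOf ?_ (Finset.mem_range.2 hx) ⟨s, ?_, ?_⟩ ?_
  · intro p hp w hw hwp
    rw [mem_instanceOf] at hp
    have hw := Finset.mem_range.1 hw
    obtain ⟨b, hb, hc⟩ := hac p.1 hp.1 p.2 hp.2 w hw hwp
    refine ⟨b, mem_instanceOf.2 ⟨hw, hb⟩, ?_⟩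
    simpa [instanceOf, hp, hw, hb, hwp.symm] using hc
  · intro v hv
    obtain ⟨hvx, hv⟩ := Finset.mem_erase.1 hv
    have hv := Finset.mem_range.1 hv
    exact mem_instanceOf.2 ⟨hv, hs v hv hvx⟩
  · intro v hv w hw hvw
    obtain ⟨hvx, hv⟩ := Finset.mem_erase.1 hv
    obtain ⟨hwx, hw⟩ := Finset.mem_erase.1 hw
    have hv := Finset.mem_range.1 hv
    have hw := Finset.mem_range.1 hw
    have h1 := hs v hv hvx
    have h2 := hs w hw hwx
    rcases lt_or_gt_of_ne hvw with h | h
    · simpa [instanceOf, hv, hw, h1, h2, hvw, h] using hs' v hv w hw hvx hwx h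
    · simpa [instanceOf, hv, hw, h1, h2, hvw, h, h.not_gt] using hs' w hw v hv hwx hvx h
  · rintro ⟨s, hs⟩
    exact hns s hs.instanceOf.1 hs.instanceOf.2

end instanceOf

/-- Three Boolean variables, any two of which must differ. -/
def oddCycle : QPattern :=
  instanceOf 3 2 (by decide) (fun _ => 2) (by decide) fun _ a _ b => a != b

/-- The variable `0` selects one of the Boolean variables `1, 2, 3`; the two others are then forced
to take the value `1`, but any two variables with value `1` are incompatible. -/
def selector : QPattern :=
  instanceOf 4 0 (by decide) (fun v => if v = 0 then 3 else 2) (by decide) fun v a w b =>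
    if v = 0 then b != 0 || a + 1 == w else a == 0 || b == 0

/-- Two blocks `1, 2, 3` and `4, 5, 6`, each encoding a 2-colouring of a triangle, which is relaxed
by an additional value `2` of the variables `1` and `4`; the values of `0` each forbid one of these
additional values. -/
def pointRelaxation : QPattern :=
  instanceOf 7 0 (by decide) (fun v => if v = 1 ∨ v = 4 then 3 else 2) (by decide)
    fun v a w b =>
      if v = 0 then !(b == 2 && (w == 1 && a == 0 || w == 4 && a == 1))
      else decide (v ≤ 3 ∧ 4 ≤ w) || a != b

/-- Two blocks `1, 2, 3` and `4, 5, 6`, each encoding a 2-colouring of a triangle together with an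
alternative constant solution `2`; the values of `0` each forbid the alternative solution in one of
the blocks. -/
def blockRelaxation : QPattern :=
  instanceOf 7 0 (by decide) (fun v => if v = 0 then 2 else 3) (by decide)
    fun v a w b =>
      if v = 0 then !(b == 2 && (decide (a = 0 ↔ w ≤ 3)))
      else decide (v ≤ 3 ∧ 4 ≤ w) || (a == 2 && b == 2) || (decide (a < 2 ∧ b < 2) && a != b)

variable {P : QPattern}

theorem VarElimPattern.embeds_oddCycle (hP : P.VarElimPattern) (hflat : P.Flat)
    (hirr : P.Irreducible) : P.Embeds oddCycle 2 := by
  refine hP.embeds_instanceOf hflat hirr (by decide +kernel) id (by decide) (by decide) ?_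
  intro s hs hr
  have h0 := hs 0 (by decide)
  have h1 := hs 1 (by decide)
  have h2 := hs 2 (by decide)
  have h01 := hr 0 (by decide) 1 (by decide) (by decide)
  have h02 := hr 0 (by decide) 2 (by decide) (by decide)
  have h12 := hr 1 (by decide) 2 (by decide) (by decide)
  simp only [bne_iff_ne] at h01 h02 h12
  omega

theorem VarElimPattern.embeds_selector (hP : P.VarElimPattern) (hflat : P.Flat)
    (hirr : P.Irreducible) : P.Embeds selector 0 := by
  refine hP.embeds_instanceOf hflat hirr (by decide +kernel) (fun _ => 0) (by decide)
    (by decide) ?_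
  intro s hs hr
  have h0 := hs 0 (by decide)
  have h01 := hr 0 (by decide) 1 (by decide) (by decide)
  have h02 := hr 0 (by decide) 2 (by decide) (by decide)
  have h03 := hr 0 (by decide) 3 (by decide) (by decide)
  have h12 := hr 1 (by decide) 2 (by decide) (by decide)
  have h13 := hr 1 (by decide) 3 (by decide) (by decide)
  have h23 := hr 2 (by decide) 3 (by decide) (by decide)
  simp at h0 h01 h02 h03 h12 h13 h23
  omega

theorem VarElimPattern.embeds_pointRelaxation (hP : P.VarElimPattern) (hflat : P.Flat)
    (hirr : P.Irreducible) : P.Embeds pointRelaxation 0 := by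
  refine hP.embeds_instanceOf hflat hirr (by decide +kernel)
    (fun v => if v = 1 ∨ v = 4 then 2 else if v = 2 ∨ v = 5 then 1 else 0) (by decide)
    (by decide) ?_
  intro s hs hr
  have h0 := hs 0 (by decide)
  have h1 := hs 1 (by decide)
  have h2 := hs 2 (by decide)
  have h3 := hs 3 (by decide)
  have h4 := hs 4 (by decide)
  have h5 := hs 5 (by decide)
  have h6 := hs 6 (by decide)
  have h01 := hr 0 (by decide) 1 (by decide) (by decide)
  have h04 := hr 0 (by decide) 4 (by decide) (by decide)
  have h12 := hr 1 (by decide) 2 (by decide) (by decide)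
  have h13 := hr 1 (by decide) 3 (by decide) (by decide)
  have h23 := hr 2 (by decide) 3 (by decide) (by decide)
  have h45 := hr 4 (by decide) 5 (by decide) (by decide)
  have h46 := hr 4 (by decide) 6 (by decide) (by decide)
  have h56 := hr 5 (by decide) 6 (by decide) (by decide)
  simp at h0 h1 h2 h3 h4 h5 h6 h01 h04 h12 h13 h23 h45 h46 h56
  omega

theorem VarElimPattern.embeds_blockRelaxation (hP : P.VarElimPattern) (hflat : P.Flat)
    (hirr : P.Irreducible) : P.Embeds blockRelaxation 0 := by
  refine hP.embeds_instanceOf hflat hirr (by decide +kernel) (fun _ => 2) (by decide)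
    (by decide) ?_
  intro s hs hr
  have h0 := hs 0 (by decide)
  have h1 := hs 1 (by decide)
  have h2 := hs 2 (by decide)
  have h3 := hs 3 (by decide)
  have h4 := hs 4 (by decide)
  have h5 := hs 5 (by decide)
  have h6 := hs 6 (by decide)
  have h01 := hr 0 (by decide) 1 (by decide) (by decide)
  have h04 := hr 0 (by decide) 4 (by decide) (by decide)
  have h12 := hr 1 (by decide) 2 (by decide) (by decide)
  have h13 := hr 1 (by decide) 3 (by decide) (by decide)
  have h23 := hr 2 (by decide) 3 (by decide) (by decide)
  have h45 := hr 4 (by decide) 5 (by decide) (by decide)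
  have h46 := hr 4 (by decide) 6 (by decide) (by decide)
  have h56 := hr 5 (by decide) 6 (by decide) (by decide)
  simp at h0 h1 h2 h3 h4 h5 h6 h01 h04 h12 h13 h23 h45 h46 h56
  omega


theorem selector_noVee : selector.NoVee 0 := by decide +kernel

theorem pointRelaxation_noApex : pointRelaxation.NoApex 0 := by decide +kernel

theorem selector_noZigzag : selector.NoZigzag 0 := by decide +kernel

theorem blockRelaxation_noHook : blockRelaxation.NoHook 0 := by decide +kernel

theorem selector_noFork : selector.NoFork 0 := by decide +kernel

theorem selector_noKite : selector.NoKite 0 := by decide +kernel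

theorem selector_noCycle : selector.NoCycle 0 := by decide +kernel

end QPattern

namespace QPattern

/-! ### Irreducible sub-patterns of the odd cycle

A sub-pattern of `oddCycle` is described by the tables of its edges between the variables
`y, z`, between `y, x` and between `z, x`. -/

/-- The edges between the Boolean values of the variables `v` and `w`. -/
def edge (S : QPattern) (v w : ℕ) (a b : Bool) : Bool :=
  (S.cpt (v, a.toNat) (w, b.toNat)).isSome

/-- The sub-pattern of `oddCycle` with the given edges avoids the configurations of `NoVee`,
`NoApex`, `NoZigzag`, `NoHook`, `NoFork`, `NoKite` and `NoCycle`, up to swapping `y` and `z`. -/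
def Avoids (yz yx zx : Bool → Bool → Bool) : Prop :=
  ∀ a, ¬ (yz a a ∧ zx a a) ∧ ¬ (yx a a ∧ zx a a) ∧ ¬ (zx a a ∧ zx (!a) a ∧ zx (!a) (!a)) ∧
    ¬ (yz a a ∧ yz a (!a) ∧ yx a (!a) ∧ zx (!a) (!a)) ∧
    ¬ (yz a a ∧ yz (!a) a ∧ yz (!a) (!a) ∧ yx (!a) a ∧ zx (!a) a) ∧
    ¬ (yz a a ∧ yz a (!a) ∧ yz (!a) a ∧ yx (!a) a ∧ zx (!a) a) ∧
    ¬ (yz (!a) a ∧ yx (!a) a ∧ zx a (!a) ∧ zx (!a) a ∧ zx (!a) (!a))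

/-- The values of a variable are neither dangling nor mergeable, where `f` and `g` are its edges
to the two other variables. -/
def RowsReduced (f g : Bool → Bool → Bool) : Prop :=
  (∀ a, f a (!a) → f a a ∨ g a a ∨ g a (!a)) ∧ (∀ a, g a (!a) → g a a ∨ f a a ∨ f a (!a)) ∧
    ((∃ c, f false c ∨ g false c) → (∃ c, f true c ∨ g true c) →
      ∃ c, f false c ∧ f true c ∨ g false c ∧ g true c)

/-- Renaming the values of `y, z, x` by `k₀, k₁, k₂` maps the given edges to edges of `T`. -/
def Fits (T : QPattern) (k₀ k₁ k₂ : Bool) (yz yx zx : Bool → Bool → Bool) : Prop :=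
  ∀ a b,
    (yz a b → T.cpt (0, (a ^^ k₀).toNat) (1, (b ^^ k₁).toNat) = some (a != b)) ∧
    (yx a b → T.cpt (0, (a ^^ k₀).toNat) (2, (b ^^ k₂).toNat) = some (a != b)) ∧
    (zx a b → T.cpt (1, (a ^^ k₁).toNat) (2, (b ^^ k₂).toNat) = some (a != b))

/-- Some renaming of the values of `y, z, x` maps the given edges to edges of one of the patterns
`BTPpat`, `invsubBTPpat` and `snakePat`. -/
def FitsSome (yz yx zx : Bool → Bool → Bool) : Prop :=
  ∃ a, BTPpat.Fits a (!a) (!a) yz yx zx ∨ invsubBTPpat.Fits a (!a) a yz yx zx ∨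
    snakePat.Fits a (!a) a yz yx zx

/-- The Boolean function of two variables with the given values. -/
def table (b₀ b₁ b₂ b₃ a b : Bool) : Bool :=
  bif a then bif b then b₃ else b₂ else bif b then b₁ else b₀

theorem exists_eq_table (f : Bool → Bool → Bool) : ∃ b₀ b₁ b₂ b₃, f = table b₀ b₁ b₂ b₃ :=
  ⟨f false false, f false true, f true false, f true true, by
    funext a b; cases a <;> cases b <;> rfl⟩

instance (yz yx zx : Bool → Bool → Bool) : Decidable (Avoids yz yx zx) := by
  unfold Avoids; infer_instance

instance (f g : Bool → Bool → Bool) : Decidable (RowsReduced f g) := by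
  unfold RowsReduced; infer_instance

instance (T : QPattern) (k₀ k₁ k₂ : Bool) (yz yx zx : Bool → Bool → Bool) :
    Decidable (T.Fits k₀ k₁ k₂ yz yx zx) := by
  unfold Fits; infer_instance

instance (yz yx zx : Bool → Bool → Bool) : Decidable (FitsSome yz yx zx) := by
  unfold FitsSome; infer_instance

set_option synthInstance.maxSize 1000 in
set_option synthInstance.maxHeartbeats 400000 in
theorem fits_of_avoids {yz yx zx : Bool → Bool → Bool} (h : Avoids yz yx zx)
    (h' : Avoids (flip yz) zx yx) (hy : RowsReduced yz yx) (hz : RowsReduced (flip yz) zx)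
    (hx : RowsReduced (flip yx) (flip zx)) (hne : ∃ a b, yx a b ∨ zx a b) :
    FitsSome yz yx zx ∨ FitsSome (flip yz) zx yx := by
  obtain ⟨b₀, b₁, b₂, b₃, rfl⟩ := exists_eq_table yz
  obtain ⟨c₀, c₁, c₂, c₃, rfl⟩ := exists_eq_table yx
  obtain ⟨d₀, d₁, d₂, d₃, rfl⟩ := exists_eq_table zx
  revert b₀ b₁ b₂ b₃ c₀ c₁ c₂ c₃ d₀ d₁ d₂ d₃
  decide +kernel

theorem edge_comm (S : QPattern) (v w : ℕ) (a b : Bool) : S.edge v w a b = S.edge w v b a := by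
  rw [edge, cpt_symm, edge]

theorem flip_edge (S : QPattern) (v w : ℕ) : flip (S.edge v w) = S.edge w v := by
  funext a b
  exact S.edge_comm v w b a

theorem cpt_oddCycle {v w : ℕ} (hv : v < 3) (hw : w < 3) (hvw : v ≠ w) (a b : Bool) :
    oddCycle.cpt (v, a.toNat) (w, b.toNat) = some (a != b) := by
  interval_cases v <;> interval_cases w <;> cases a <;> cases b <;> first | rfl | simp at hvw

theorem exists_toNat_of_mem_oddCycle {p : ℕ × ℕ} (hp : p ∈ oddCycle.A) :
    ∃ v < 3, ∃ a : Bool, p = (v, a.toNat) := by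
  obtain ⟨v, i⟩ := p
  obtain ⟨h1, h2⟩ := mem_instanceOf.1 hp
  refine ⟨v, h1, ?_⟩
  have h2 : i < 2 := h2
  interval_cases i
  exacts [⟨false, rfl⟩, ⟨true, rfl⟩]

variable {S : QPattern}

theorem SubPat.cpt_of_edge (hS : S.SubPat oddCycle) {v w : ℕ} {a b : Bool} (h : S.edge v w a b) :
    S.cpt (v, a.toNat) (w, b.toNat) = some (a != b) := by
  obtain ⟨hp, hq, hne⟩ := S.cpt_dom _ _ h
  rw [hS.2.2.1 _ _ h]
  exact cpt_oddCycle (Finset.mem_range.1 (hS.1 (S.A_sub _ hp)))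
    (Finset.mem_range.1 (hS.1 (S.A_sub _ hq))) hne a b

theorem SubPat.exists_edge (hS : S.SubPat oddCycle) {v u w : ℕ} {a : Bool} {q : ℕ × ℕ}
    (hvuw : ∀ t < 3, t = v ∨ t = u ∨ t = w) (h : (S.cpt (v, a.toNat) q).isSome) :
    ∃ b, q = (u, b.toNat) ∧ S.edge v u a b ∨ q = (w, b.toNat) ∧ S.edge v w a b := by
  obtain ⟨-, hq, hne⟩ := S.cpt_dom _ _ h
  obtain ⟨t, ht, b, rfl⟩ := exists_toNat_of_mem_oddCycle (hS.2.1 hq)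
  rcases hvuw t ht with rfl | rfl | rfl
  · exact absurd rfl hne
  · exact ⟨b, Or.inl ⟨rfl, h⟩⟩
  · exact ⟨b, Or.inr ⟨rfl, h⟩⟩

theorem SubPat.not_dangling_row (hS : S.SubPat oddCycle) (hirr : S.Irreducible) (hflat : S.Flat)
    {v u w : ℕ}
    (hvuw : ∀ t < 3, t = v ∨ t = u ∨ t = w) {a : Bool} (h : S.edge v u a (!a)) :
    S.edge v u a a ∨ S.edge v w a a ∨ S.edge v w a (!a) := by
  by_contra! hcon
  obtain ⟨h1, h2, h3⟩ := hcon
  have he : S.e = ∅ := hflat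
  have key : ∀ q, (S.cpt (v, a.toNat) q).isSome → q = (u, (!a).toNat) := by
    intro q hq
    obtain ⟨b, ⟨rfl, hb⟩ | ⟨rfl, hb⟩⟩ := hS.exists_edge hvuw hq <;>
      rcases Bool.eq_or_eq_not b a with rfl | rfl
    · exact absurd hb h1
    · rfl
    · exact absurd hb h2
    · exact absurd hb h3
  refine hirr.2 (v, a.toNat) ⟨(S.cpt_dom _ _ h).1,
    fun q r hq hr => (key q hq).trans (key r hr).symm, fun q hq => ?_, by simp [he]⟩
  rw [key q hq, hS.cpt_of_edge h]
  simp

theorem SubPat.rowsReduced (hS : S.SubPat oddCycle) (hirr : S.Irreducible) (hflat : S.Flat)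
    {v u w : ℕ}
    (hvuw : ∀ t < 3, t = v ∨ t = u ∨ t = w) : RowsReduced (S.edge v u) (S.edge v w) := by
  have he : S.e = ∅ := hflat
  refine ⟨fun a h => hS.not_dangling_row hirr hflat hvuw h, fun a h =>
    hS.not_dangling_row hirr hflat (fun t ht => (hvuw t ht).imp_right Or.symm) h, ?_⟩
  rintro ⟨c, hc⟩ ⟨d, hd⟩
  by_contra! hcon
  have m : ∀ {a b}, S.edge v u a b ∨ S.edge v w a b → (v, a.toNat) ∈ S.A := fun h =>
    h.elim (fun h => (S.cpt_dom _ _ h).1) (fun h => (S.cpt_dom _ _ h).1)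
  refine hirr.1 v (false).toNat (true).toNat
    ⟨m hc, m hd, by decide, fun p h1 h2 => ?_, by simp [he]⟩
  have h2' := h2
  obtain ⟨b, ⟨rfl, hb⟩ | ⟨rfl, hb⟩⟩ := hS.exists_edge hvuw h1
  · exact absurd h2 ((hcon b).1 hb)
  · exact absurd h2 ((hcon b).2 hb)

theorem SubPat.avoids (hS : S.SubPat oddCycle) (hv : S.NoVee 2) (ha : S.NoApex 2)
    (hz : S.NoZigzag 2) (hh : S.NoHook 2)
    (hf : S.NoFork 2) (hk : S.NoKite 2) (hc : S.NoCycle 2) {y z : ℕ} (hyz : y ≠ z) (hy : y ≠ 2) :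
    Avoids (S.edge y z) (S.edge y 2) (S.edge z 2) := by
  have neg : ∀ {v w a}, S.edge v w a a → S.cpt (v, a.toNat) (w, a.toNat) = some false :=
    fun {v w a} h => by simpa using hS.cpt_of_edge h
  have pos : ∀ {v w a}, S.edge v w a (!a) → S.cpt (v, a.toNat) (w, (!a).toNat) = some true :=
    fun {v w a} h => by simpa using hS.cpt_of_edge h
  have pos' : ∀ {v w a}, S.edge v w (!a) a → S.cpt (v, (!a).toNat) (w, a.toNat) = some true :=
    fun {v w a} h => by simpa using hS.cpt_of_edge h
  have l : ∀ {v w a b}, S.edge v w a b → (v, a.toNat) ∈ S.A := fun h => (S.cpt_dom _ _ h).1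
  have r : ∀ {v w a b}, S.edge v w a b → (w, b.toNat) ∈ S.A := fun h => (S.cpt_dom _ _ h).2.1
  intro a
  refine ⟨?_, ?_, ?_, ?_, ?_, ?_, ?_⟩
  · rintro ⟨h1, h2⟩
    exact hv _ (r h2) rfl _ (l h2) (neg h2) _ (l h1) hy (neg h1)
  · rintro ⟨h1, h2⟩
    exact ha _ (r h1) rfl _ (l h1) (neg h1) _ (l h2) hyz (neg h2)
  · rintro ⟨h1, h2, h3⟩
    exact hz _ (r h1) rfl _ (l h1) (neg h1) _ (l h2) rfl (pos' h2) _ (r h3) rfl (neg h3)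
  · rintro ⟨h1, h2, h3, h4⟩
    exact hh _ (r h3) rfl _ (l h4) (neg h4) _ (l h3) (pos h3) (pos h2) _ (r h1) rfl (neg h1)
  · rintro ⟨h1, h2, h3, h4, h5⟩
    exact hf _ (r h5) rfl _ (l h5) (pos' h5) _ (l h4) (pos' h4) (neg h3) _ (r h2) rfl (pos' h2)
      _ (l h1) rfl (neg h1)
  · rintro ⟨h1, h2, h3, h4, h5⟩
    exact hk _ (r h5) rfl _ (l h5) (pos' h5) _ (l h4) (pos' h4) _ (l h2) rfl (pos h2)
      _ (r h3) rfl (pos' h3) (neg h1)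
  · rintro ⟨h1, h2, h3, h4, h5⟩
    exact hc _ (r h3) rfl _ (l h5) (neg h5) _ (r h4) rfl (pos' h4) _ (l h3) rfl (pos h3)
      _ (l h2) (pos' h2) (pos' h1)

theorem Irreducible.exists_cpt_isSome (hirr : S.Irreducible) (hflat : S.Flat) {p : ℕ × ℕ}
    (hp : p ∈ S.A) : ∃ q, (S.cpt p q).isSome := by
  have he : S.e = ∅ := hflat
  by_contra! hcon
  exact hirr.2 p ⟨hp, fun q _ h => absurd h (hcon q), fun q h => absurd h (hcon q), by simp [he]⟩

theorem SubPat.embeds_of_fits (hS : S.SubPat oddCycle) (hirr : S.Irreducible) (hflat : S.Flat)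
    {T : QPattern} {y z : ℕ}
    (hyz : y = 0 ∧ z = 1 ∨ y = 1 ∧ z = 0) {k₀ k₁ k₂ : Bool}
    (h : T.Fits k₀ k₁ k₂ (S.edge y z) (S.edge y 2) (S.edge z 2)) : S.Embeds T 2 := by
  let fX : ℕ → ℕ := ⇑(Equiv.swap 0 y)
  have fy : fX y = 0 := Equiv.swap_apply_right 0 y
  have fz : fX z = 1 := by rcases hyz with ⟨rfl, rfl⟩ | ⟨rfl, rfl⟩ <;> rfl
  have fx : fX 2 = 2 := by rcases hyz with ⟨rfl, rfl⟩ | ⟨rfl, rfl⟩ <;> rfl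
  set k : ℕ → Bool := fun v => if v = y then k₀ else if v = z then k₁ else k₂ with hk
  have ky : k y = k₀ := by simp [hk]
  have kz : k z = k₁ := by rcases hyz with ⟨rfl, rfl⟩ | ⟨rfl, rfl⟩ <;> simp [hk]
  have kx : k 2 = k₂ := by rcases hyz with ⟨rfl, rfl⟩ | ⟨rfl, rfl⟩ <;> simp [hk]
  have xor_toNat : ∀ a b : Bool, a.toNat ^^^ b.toNat = (a ^^ b).toNat := by decide
  have cases_lt : ∀ t < 3, t = y ∨ t = z ∨ t = 2 := by omega
  have key : ∀ p q, (S.cpt p q).isSome →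
      T.cpt (fX p.1, p.2 ^^^ (k p.1).toNat) (fX q.1, q.2 ^^^ (k q.1).toNat) = S.cpt p q := by
    intro p q hpq
    obtain ⟨hp, hq, hne⟩ := S.cpt_dom _ _ hpq
    obtain ⟨v, hv, a, rfl⟩ := exists_toNat_of_mem_oddCycle (hS.2.1 hp)
    obtain ⟨w, hw, b, rfl⟩ := exists_toNat_of_mem_oddCycle (hS.2.1 hq)
    have hE : S.edge v w a b := hpq
    have hE' : S.edge w v b a := by rw [edge_comm]; exact hE
    have hsymm : (a != b) = (b != a) := Bool.xor_comm a b
    rw [hS.cpt_of_edge hE]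
    simp only [xor_toNat]
    rcases cases_lt v hv with rfl | rfl | rfl <;> rcases cases_lt w hw with rfl | rfl | rfl
    · exact absurd rfl hne
    · rw [fy, fz, ky, kz]; exact (h a b).1 hE
    · rw [fy, fx, ky, kx]; exact (h a b).2.1 hE
    · rw [fy, fz, ky, kz, T.cpt_symm, hsymm]; exact (h b a).1 hE'
    · exact absurd rfl hne
    · rw [fz, fx, kz, kx]; exact (h a b).2.2 hE
    · rw [fy, fx, ky, kx, T.cpt_symm, hsymm]; exact (h b a).2.1 hE'
    · rw [fz, fx, kz, kx, T.cpt_symm, hsymm]; exact (h b a).2.2 hE'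
    · exact absurd rfl hne
  have mem : ∀ p ∈ S.A, (fX p.1, p.2 ^^^ (k p.1).toNat) ∈ T.A := by
    intro p hp
    obtain ⟨q, hq⟩ := hirr.exists_cpt_isSome hflat hp
    exact (T.cpt_dom _ _ (by rw [key p q hq]; exact hq)).1
  refine ⟨fX, fun v b => b ^^^ (k v).toNat, ⟨(Equiv.swap 0 y).injective.injOn, ?_, mem, ?_,
    fun p _ q _ h => key p q h⟩, ?_⟩
  · intro v hv
    obtain ⟨a, ha⟩ := S.dom_ne v hv
    exact T.A_sub _ (mem _ ha)
  · exact fun v a _ b _ hab => Nat.xor_left_inj.1 hab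
  · rw [hS.2.2.2.1]; exact fx

theorem SubPat.embeds_of_avoids (hS : S.SubPat oddCycle) (hirr : S.Irreducible) (hflat : S.Flat)
    (h : Avoids (S.edge 0 1) (S.edge 0 2) (S.edge 1 2))
    (h' : Avoids (S.edge 1 0) (S.edge 1 2) (S.edge 0 2)) :
    S.Embeds BTPpat 2 ∨ S.Embeds invsubBTPpat 2 ∨ S.Embeds snakePat 2 := by
  have hne : ∃ a b, S.edge 0 2 a b ∨ S.edge 1 2 a b := by
    have hx : S.vbar = 2 := hS.2.2.2.1
    obtain ⟨i, hi⟩ := S.dom_ne 2 (hx ▸ S.vbar_mem)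
    obtain ⟨q, hq⟩ := hirr.exists_cpt_isSome hflat hi
    obtain ⟨v, hv, a, hva⟩ := exists_toNat_of_mem_oddCycle (hS.2.1 hi)
    rw [hva] at hq
    obtain rfl : 2 = v := congrArg Prod.fst hva
    obtain ⟨b, ⟨-, hb⟩ | ⟨-, hb⟩⟩ := hS.exists_edge (u := 0) (w := 1) (by omega) hq <;>
      rw [edge_comm] at hb
    exacts [⟨b, a, Or.inl hb⟩, ⟨b, a, Or.inr hb⟩]
  have hy : RowsReduced (S.edge 0 1) (S.edge 0 2) := hS.rowsReduced hirr hflat (by omega)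
  have hz : RowsReduced (S.edge 1 0) (S.edge 1 2) := hS.rowsReduced hirr hflat (by omega)
  have hx : RowsReduced (S.edge 2 0) (S.edge 2 1) := hS.rowsReduced hirr hflat (by omega)
  have H := fits_of_avoids h (by rwa [flip_edge]) hy (by rwa [flip_edge])
    (by rwa [flip_edge, flip_edge]) hne
  rw [flip_edge] at H
  have e {y z : ℕ} (hyz : y = 0 ∧ z = 1 ∨ y = 1 ∧ z = 0)
      (H : FitsSome (S.edge y z) (S.edge y 2) (S.edge z 2)) :
      S.Embeds BTPpat 2 ∨ S.Embeds invsubBTPpat 2 ∨ S.Embeds snakePat 2 :=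
    H.elim fun _ => Or.imp (hS.embeds_of_fits hirr hflat hyz)
      (Or.imp (hS.embeds_of_fits hirr hflat hyz) (hS.embeds_of_fits hirr hflat hyz))
  exact H.elim (e (Or.inl ⟨rfl, rfl⟩)) (e (Or.inr ⟨rfl, rfl⟩))

theorem VarElimPattern.embeds_of_flat {P : QPattern} (hP : P.VarElimPattern) (hflat : P.Flat)
    (hirr : P.Irreducible) :
    P.Embeds BTPpat 2 ∨ P.Embeds invsubBTPpat 2 ∨ P.Embeds snakePat 2 := by
  obtain ⟨S, hSf, hSi, hS, hPS, hSP⟩ :=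
    exists_subPat_of_embeds hflat hirr (hP.embeds_oddCycle hflat hirr)
  have hx : S.vbar = 2 := hS.2.2.2.1
  have hsel := hSP.trans (hP.embeds_selector hflat hirr)
  have hpt := hSP.trans (hP.embeds_pointRelaxation hflat hirr)
  have hbl := hSP.trans (hP.embeds_blockRelaxation hflat hirr)
  have hav {y z : ℕ} (hyz : y ≠ z) (hy : y ≠ 2) :
      Avoids (S.edge y z) (S.edge y 2) (S.edge z 2) :=
    hS.avoids (hx ▸ selector_noVee.of_embeds hsel) (hx ▸ pointRelaxation_noApex.of_embeds hpt)
      (hx ▸ selector_noZigzag.of_embeds hsel) (hx ▸ blockRelaxation_noHook.of_embeds hbl)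
      (hx ▸ selector_noFork.of_embeds hsel) (hx ▸ selector_noKite.of_embeds hsel)
      (hx ▸ selector_noCycle.of_embeds hsel) hyz hy
  have h := hPS.embeds
  exact (hS.embeds_of_avoids hSi hSf (hav (by decide) (by decide))
    (hav (by decide) (by decide))).imp h.trans (Or.imp h.trans h.trans)

end QPattern

/-- an irreducible flat quantified pattern is a var-elim pattern iff
it is equivalent to BTP, invsubBTP, snake, or to an irreducible sub-pattern of one
of them. -/
theorem flat_var_elim_characterisation (P : QPattern)
    (hflat : P.Flat) (hirr : P.Irreducible) :
    P.VarElimPattern ↔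
      (P.EquivPat BTPpat ∨ P.EquivPat invsubBTPpat ∨ P.EquivPat snakePat ∨
        ∃ S : QPattern, S.Irreducible ∧
          (S.SubPat BTPpat ∨ S.SubPat invsubBTPpat ∨ S.SubPat snakePat) ∧
          P.EquivPat S) := by
  constructor
  · intro hP
    refine Or.inr (Or.inr (Or.inr ?_))
    rcases hP.embeds_of_flat hflat hirr with h | h | h <;>
      obtain ⟨S, -, hS, hST, hPS, -⟩ := QPattern.exists_subPat_of_embeds hflat hirr h
    exacts [⟨S, hS, Or.inl hST, hPS⟩, ⟨S, hS, Or.inr (Or.inl hST), hPS⟩,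
      ⟨S, hS, Or.inr (Or.inr hST), hPS⟩]
  · intro h
    have h : P.Embeds BTPpat 2 ∨ P.Embeds invsubBTPpat 2 ∨ P.Embeds snakePat 2 := by
      rcases h with h | h | h | ⟨S, -, h | h | h, hPS⟩
      exacts [Or.inl h.embeds, Or.inr (Or.inl h.embeds), Or.inr (Or.inr h.embeds),
        Or.inl (hPS.embeds.trans h.embeds), Or.inr (Or.inl (hPS.embeds.trans h.embeds)),
        Or.inr (Or.inr (hPS.embeds.trans h.embeds))]
    rcases h with h | h | h
    · exact QPattern.varElimPattern_of_embeds hflat h fun Q hQ hac x hx hT hs =>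
        QPattern.exists_sol_of_not_embeds_BTPpat hQ hac hx hT hs
    · exact QPattern.varElimPattern_of_embeds hflat h fun Q hQ hac x hx hT hs =>
        QPattern.exists_sol_of_not_embeds_invsubBTPpat hQ hac hx hT hs
    · exact QPattern.varElimPattern_of_embeds hflat h fun Q hQ hac x hx hT hs =>
        QPattern.exists_sol_of_not_embeds_snakePat hQ hac hx hT hs
end

section
/- Consider the binary CSP instance I (2-colouring of the complete graph on three vertices) with three variables x₁, x₂, x₃, each with domain {0,1}, where for all i ≠ j, cpt(⟨xᵢ,a⟩,⟨xⱼ,b⟩)=TRUE if and only if a ≠ b. Then: (i) I is arc-consistent; (ii) for every pair of distinct variables, I has a partial solution on that pair (in particular I has a partial solution on all variables except x₃); (iii) I has no solution; and (iv) I contains no compatibility triangle, i.e., there are no three pairwise-compatible assignments to three distinct variables. Consequently, forbidding the pattern Triangle (three pairwise-compatible assignments to three distinct variables) does not allow variable elimination in arc-consistent binary CSP instances. -/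
/-- The instance `I^{2COL}_3`: 2-colouring of the complete graph on three vertices. -/
def I15 : BinaryCSP (Fin 3) (Fin 2) where
  dom := fun _ => Finset.univ
  cpt := fun _ a _ b => a != b
  symm := by decide

/-- the instance `I15` is arc-consistent, has a partial solution on
every pair of distinct variables (in particular on all variables except `x₃`), has
no solution, and contains no triangle of pairwise-compatible assignments to three
distinct variables.  Consequently, forbidding the pattern Triangle does not allow
variable elimination in arc-consistent binary CSP instances. -/
theorem triangle_not_var_elim :
    I15.ArcConsistent ∧
    (∀ i j : Fin 3, i ≠ j → ∃ s, I15.PartialSol {i, j} s) ∧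
    (∃ s, I15.PartialSol {v | v ≠ (2 : Fin 3)} s) ∧
    (¬ ∃ s, I15.Sol s) ∧
    (¬ ∃ (u v w : Fin 3) (a b c : Fin 2),
      u ≠ v ∧ u ≠ w ∧ v ≠ w ∧
      a ∈ I15.dom u ∧ b ∈ I15.dom v ∧ c ∈ I15.dom w ∧
      I15.cpt u a v b = true ∧ I15.cpt u a w c = true ∧ I15.cpt v b w c = true) ∧
    ¬ (∀ (V D : Type), ∀ _ : Fintype V, ∀ I : BinaryCSP V D,
        (∀ v, (I.dom v).Nonempty) → I.ArcConsistent →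
        (¬ ∃ (u v w : V) (a b c : D),
          u ≠ v ∧ u ≠ w ∧ v ≠ w ∧
          a ∈ I.dom u ∧ b ∈ I.dom v ∧ c ∈ I.dom w ∧
          I.cpt u a v b = true ∧ I.cpt u a w c = true ∧ I.cpt v b w c = true) →
        ∀ x : V, (∃ s, I.PartialSol {v | v ≠ x} s) → ∃ s, I.Sol s) := by
  have arc : I15.ArcConsistent := by
    intro v a _ w _
    have h : ∀ a : Fin 2, (a != a + 1) = true := by decide
    exact ⟨a + 1, Finset.mem_univ _, h a⟩
  have pair : ∀ i j : Fin 3, i ≠ j → ∃ s, I15.PartialSol {i, j} s := by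
    intro i j hij
    refine ⟨fun v => if v = i then 0 else 1, fun _ _ => Finset.mem_univ _, ?_⟩
    rintro v (rfl | rfl) w (rfl | rfl) hvw <;> simp_all [I15, eq_comm]
  have two : ∃ s, I15.PartialSol {v | v ≠ (2 : Fin 3)} s := by
    obtain ⟨s, hs⟩ := pair 0 1 (by decide)
    have h : {v | v ≠ (2 : Fin 3)} = {0, 1} := by
      ext v
      fin_cases v <;> simp
    exact ⟨s, h ▸ hs⟩
  have colour : ∀ a b c : Fin 2, (a != b) = true → (a != c) = true → (b != c) = true → False := by
    decide
  have triangle : ¬ ∃ (u v w : Fin 3) (a b c : Fin 2),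
      u ≠ v ∧ u ≠ w ∧ v ≠ w ∧
      a ∈ I15.dom u ∧ b ∈ I15.dom v ∧ c ∈ I15.dom w ∧
      I15.cpt u a v b = true ∧ I15.cpt u a w c = true ∧ I15.cpt v b w c = true := by
    rintro ⟨_, _, _, a, b, c, _, _, _, _, _, _, hab, hac, hbc⟩
    exact colour a b c hab hac hbc
  have unsat : ¬ ∃ s, I15.Sol s := by
    rintro ⟨s, hdom, hcpt⟩
    exact colour (s 0) (s 1) (s 2)
      (hcpt 0 trivial 1 trivial (by decide)) (hcpt 0 trivial 2 trivial (by decide))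
      (hcpt 1 trivial 2 trivial (by decide))
  exact ⟨arc, pair, two, unsat, triangle, fun h =>
    unsat (h _ _ inferInstance I15 (fun _ => Finset.univ_nonempty) arc triangle 2 two)⟩
end

section
/- Consider the binary CSP instance I (the 2SAT instance I^{SAT}₄) with four Boolean variables x₁, x₂, x₃, x, each with domain {0,1}, whose nontrivial constraints are: x₁ = x₂, x₁ = x₃, x₂ ∨ x₃, ¬x₂ ∨ x, ¬x₃ ∨ ¬x (a pair of assignments is compatible if and only if it violates no constraint; pairs of variables with no listed constraint are unconstrained, so all their value pairs are compatible). Then: (i) I is arc-consistent; (ii) I has a partial solution on {x₁,x₂,x₃}; (iii) I has no solution; and (iv) for every value r ∈ {0,1}, there is at most one variable y ≠ x containing an assignment incompatible with ⟨x,r⟩, so there do not exist a value r ∈ D(x), distinct variables y, z ≠ x, and values p ∈ D(y), q ∈ D(z) with cpt(⟨y,p⟩,⟨x,r⟩)=FALSE and cpt(⟨z,q⟩,⟨x,r⟩)=FALSE. Consequently, the pattern Pivot(sym) is not a var-elim pattern. -/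
/-- Compatibility function of the 2SAT instance `I^{SAT}₄` on Boolean variables
`x₁, x₂, x₃, x` (numbered `0,1,2,3`), with constraints
`x₁ = x₂`, `x₁ = x₃`, `x₂ ∨ x₃`, `¬x₂ ∨ x`, `¬x₃ ∨ ¬x`. -/
def cpt16 (i : Fin 4) (a : Bool) (j : Fin 4) (b : Bool) : Bool :=
  match i.val, j.val with
  | 0, 1 => a == b
  | 1, 0 => a == b
  | 0, 2 => a == b
  | 2, 0 => a == b
  | 1, 2 => a || b
  | 2, 1 => a || b
  | 1, 3 => !a || b
  | 3, 1 => !b || a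
  | 2, 3 => !a || !b
  | 3, 2 => !b || !a
  | _, _ => true

/-- The 2SAT instance `I^{SAT}₄`. -/
def I16 : BinaryCSP (Fin 4) Bool where
  dom := fun _ => Finset.univ
  cpt := cpt16
  symm := by decide

theorem I16_arcConsistent : I16.ArcConsistent := by
  unfold BinaryCSP.ArcConsistent I16
  decide

theorem I16_partialSol_true : I16.PartialSol {v | v ≠ 3} fun _ => true := by
  refine ⟨fun v _ => Finset.mem_univ _, ?_⟩
  change ∀ v : Fin 4, v ≠ 3 → ∀ w : Fin 4, w ≠ 3 → v ≠ w → cpt16 v true w true = true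
  decide

theorem I16_not_sol : ¬ ∃ s, I16.Sol s := by
  rintro ⟨s, -, hs⟩
  have h (v w : Fin 4) (hvw : v ≠ w) : cpt16 v (s v) w (s w) = true :=
    hs v trivial w trivial hvw
  have h01 := h 0 1 (by decide)
  have h02 := h 0 2 (by decide)
  have h12 := h 1 2 (by decide)
  have h13 := h 1 3 (by decide)
  have h23 := h 2 3 (by decide)
  revert h01 h02 h12 h13 h23
  generalize s 0 = a, s 1 = b, s 2 = c, s 3 = d
  revert a b c d
  decide

theorem I16_not_pivotSym : ¬ ∃ (r : Bool) (y z : Fin 4) (p q : Bool),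
    r ∈ I16.dom 3 ∧ y ≠ 3 ∧ z ≠ 3 ∧ y ≠ z ∧ p ∈ I16.dom y ∧ q ∈ I16.dom z ∧
      I16.cpt y p 3 r = false ∧ I16.cpt z q 3 r = false := by
  rintro ⟨r, y, z, p, q, -, hy, hz, hyz, -, -, hp, hq⟩
  have key : ∀ (r : Bool) (y z : Fin 4) (p q : Bool), y ≠ 3 → z ≠ 3 → y ≠ z →
      cpt16 y p 3 r = false → cpt16 z q 3 r ≠ false := by decide
  exact key r y z p q hy hz hyz hp hq

/-- `I16` is arc-consistent, has a partial solution on `{x₁,x₂,x₃}`,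
has no solution, and for every value `r` of `x` there is at most one other variable
carrying an assignment incompatible with `⟨x,r⟩` (so Pivot(sym) does not occur at
`x`).  Consequently, the pattern Pivot(sym) is not a var-elim pattern. -/
theorem pivotSym_not_var_elim :
    I16.ArcConsistent ∧
    (∃ s, I16.PartialSol {0, 1, 2} s) ∧
    (¬ ∃ s, I16.Sol s) ∧
    (¬ ∃ (r : Bool) (y z : Fin 4) (p q : Bool),
      r ∈ I16.dom 3 ∧ y ≠ 3 ∧ z ≠ 3 ∧ y ≠ z ∧
      p ∈ I16.dom y ∧ q ∈ I16.dom z ∧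
      I16.cpt y p 3 r = false ∧ I16.cpt z q 3 r = false) ∧
    ¬ (∀ (V D : Type), ∀ _ : Fintype V, ∀ I : BinaryCSP V D,
        (∀ v, (I.dom v).Nonempty) → I.ArcConsistent →
        ∀ x : V,
        (¬ ∃ (r : D) (y z : V) (p q : D),
          r ∈ I.dom x ∧ y ≠ x ∧ z ≠ x ∧ y ≠ z ∧
          p ∈ I.dom y ∧ q ∈ I.dom z ∧
          I.cpt y p x r = false ∧ I.cpt z q x r = false) →
        (∃ s, I.PartialSol {v | v ≠ x} s) → ∃ s, I.Sol s) := by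
  refine ⟨I16_arcConsistent, ⟨fun _ => true, ?_⟩, I16_not_sol, I16_not_pivotSym, fun h => ?_⟩
  · convert I16_partialSol_true using 1
    ext v
    fin_cases v <;> simp
  · exact I16_not_sol (h (Fin 4) Bool inferInstance I16 (fun _ => Finset.univ_nonempty)
      I16_arcConsistent 3 I16_not_pivotSym ⟨_, I16_partialSol_true⟩)
end

section
/- Consider the binary CSP instance I (the instance I^∃₄) with four variables x₁, x₂, x₃, x, where D(x₁)=D(x₂)=D(x₃)={0,1,2} and D(x)={0,1,2,3}; for 1 ≤ i < j ≤ 3, the pair ⟨xᵢ,xⱼ⟩ must take values in {(0,0),(1,2),(2,1)}; and for i = 1,2,3, the assignments ⟨xᵢ,a⟩ and ⟨x,c⟩ are compatible if and only if a > 0 or c = i. Then: (i) I is arc-consistent; (ii) I has a partial solution on {x₁,x₂,x₃}; (iii) I has no solution; and (iv) for the value d = 0 ∈ D(x), every assignment ⟨y,p⟩ with y ≠ x that is compatible with ⟨x,0⟩ is compatible with ⟨x,c⟩ for every c ∈ D(x). Consequently, the pattern V(+−) (an assignment to another variable compatible with the existential value of x and incompatible with some other value of x) is not a var-elim pattern.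 -/
/-- The relation `R = {(0,0),(1,2),(2,1)}` between the variables `x₁,x₂,x₃`. -/
def R17 (a b : Fin 4) : Bool :=
  (a == 0 && b == 0) || (a == 1 && b == 2) || (a == 2 && b == 1)

/-- Compatibility function of the instance `I^∃₄`: variables `x₁,x₂,x₃,x` are
numbered `0,1,2,3`; pairs among `x₁,x₂,x₃` must take values in `R17`; and for
`i = 0,1,2`, assignments `⟨xᵢ₊₁,a⟩` and `⟨x,c⟩` are compatible iff `a > 0` or
`c = i+1`. -/
def cpt17 (i : Fin 4) (a : Fin 4) (j : Fin 4) (b : Fin 4) : Bool :=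
  match i.val, j.val with
  | 3, 3 => true
  | 3, _ => (b != 0) || ((a : ℕ) == (j : ℕ) + 1)
  | _, 3 => (a != 0) || ((b : ℕ) == (i : ℕ) + 1)
  | _, _ => R17 a b

/-- The instance `I^∃₄`: `D(x₁)=D(x₂)=D(x₃)={0,1,2}` and `D(x)={0,1,2,3}`. -/
def I17 : BinaryCSP (Fin 4) (Fin 4) where
  dom := fun i => if i = 3 then Finset.univ else {0, 1, 2}
  cpt := cpt17
  symm := by decide

theorem I17_arcConsistent : I17.ArcConsistent := by
  unfold BinaryCSP.ArcConsistent
  decide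

theorem I17_partialSol_zero : I17.PartialSol {v | v ≠ 3} (fun _ => 0) := by
  simp only [BinaryCSP.PartialSol, Set.mem_ofPred_eq]
  decide

theorem cpt17_not_jointly_satisfiable : ∀ a b c d : Fin 4,
    cpt17 0 a 1 b = true → cpt17 0 a 2 c = true → cpt17 1 b 2 c = true →
    cpt17 0 a 3 d = true → cpt17 1 b 3 d = true → cpt17 2 c 3 d = true → False := by
  decide

theorem I17_not_sol : ¬ ∃ s, I17.Sol s := by
  rintro ⟨s, -, h⟩
  have h' : ∀ v w : Fin 4, v ≠ w → cpt17 v (s v) w (s w) = true :=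
    fun v w => h v (Set.mem_univ v) w (Set.mem_univ w)
  exact cpt17_not_jointly_satisfiable (s 0) (s 1) (s 2) (s 3)
    (h' 0 1 (by decide)) (h' 0 2 (by decide)) (h' 1 2 (by decide))
    (h' 0 3 (by decide)) (h' 1 3 (by decide)) (h' 2 3 (by decide))

theorem I17_compatible_zero_imp : ∀ y p : Fin 4, y ≠ 3 → p ∈ I17.dom y →
    I17.cpt y p 3 0 = true → ∀ c ∈ I17.dom 3, I17.cpt y p 3 c = true := by
  decide

/-- `I17` is arc-consistent, has a partial solution on `{x₁,x₂,x₃}`,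
has no solution, and every assignment to another variable compatible with `⟨x,0⟩`
is compatible with every value of `x` (so V(+−) does not occur at `x` for `a ↦ 0`).
Consequently, the pattern V(+−) is not a var-elim pattern. -/
theorem vPlusMinus_not_var_elim :
    I17.ArcConsistent ∧
    (∃ s, I17.PartialSol {0, 1, 2} s) ∧
    (¬ ∃ s, I17.Sol s) ∧
    (∀ (y : Fin 4) (p : Fin 4), y ≠ 3 → p ∈ I17.dom y →
      I17.cpt y p 3 0 = true → ∀ c ∈ I17.dom 3, I17.cpt y p 3 c = true) ∧
    ¬ (∀ (V D : Type), ∀ _ : Fintype V, ∀ I : BinaryCSP V D,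
        (∀ v, (I.dom v).Nonempty) → I.ArcConsistent →
        ∀ x : V,
        (∃ d ∈ I.dom x, ¬ ∃ (y : V) (p : D) (c : D),
          y ≠ x ∧ p ∈ I.dom y ∧ c ∈ I.dom x ∧
          I.cpt y p x d = true ∧ I.cpt y p x c = false) →
        (∃ s, I.PartialSol {v | v ≠ x} s) → ∃ s, I.Sol s) := by
  refine ⟨I17_arcConsistent, ⟨fun _ => 0, ?_⟩, I17_not_sol, I17_compatible_zero_imp, ?_⟩
  · have hsub : ∀ v ∈ ({0, 1, 2} : Set (Fin 4)), v ≠ 3 := by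
      rintro v (rfl | rfl | rfl) <;> decide
    exact ⟨fun v hv => I17_partialSol_zero.1 v (hsub v hv),
      fun v hv w hw => I17_partialSol_zero.2 v (hsub v hv) w (hsub w hw)⟩
  · intro H
    refine I17_not_sol (H (Fin 4) (Fin 4) inferInstance I17 (by decide) I17_arcConsistent 3
      ⟨0, by decide, ?_⟩ ⟨_, I17_partialSol_zero⟩)
    rintro ⟨y, p, c, hy, hp, hc, h0, h1⟩
    exact Bool.noConfusion (h1.symm.trans (I17_compatible_zero_imp y p hy hp h0 c hc))
end

section
/- For every integer k ≥ 1, consider the binary CSP instance I (the instance I^{SAT}₃) with three variables x₁, x₂, x, where D(x₁)=D(x₂)={0,1} and D(x)={0,1,…,k}, and whose nontrivial constraints are: ¬x₁ ∨ ¬x₂ (i.e., ⟨x₁,1⟩ and ⟨x₂,1⟩ are incompatible); x₁ ∨ (x=0) (i.e., ⟨x₁,0⟩ is incompatible with ⟨x,j⟩ for every j ≠ 0); and x₂ ∨ (x=0) (i.e., ⟨x₂,0⟩ is incompatible with ⟨x,j⟩ for every j ≠ 0); all other pairs of assignments are compatible. Then: (i) I is arc-consistent; (ii) the assignment ⟨x,0⟩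 is compatible with every assignment to x₁ and x₂; (iii) I has a solution with x = 0 (namely x₁=x₂=0, x=0); and (iv) the instance obtained from I by deleting the value 0 from D(x) has no solution. Consequently, any value-elimination pattern whose distinguished value belongs to an incompatibility edge (in particular the pattern I(−)) is not a val-elim pattern. -/
/-- Compatibility function of the instance `I^{SAT}₃`: variables `x₁, x₂, x` are
numbered `0, 1, 2`; the constraints are `¬x₁ ∨ ¬x₂`, `x₁ ∨ (x=0)`, `x₂ ∨ (x=0)`;
all other pairs of assignments are compatible. -/
def cpt18 (i : Fin 3) (a : ℕ) (j : Fin 3) (b : ℕ) : Bool :=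
  match i.val, j.val with
  | 0, 1 => !(a == 1 && b == 1)
  | 1, 0 => !(b == 1 && a == 1)
  | 0, 2 => !(a == 0 && b != 0)
  | 2, 0 => !(b == 0 && a != 0)
  | 1, 2 => !(a == 0 && b != 0)
  | 2, 1 => !(b == 0 && a != 0)
  | _, _ => true

/-- The instance `I^{SAT}₃` with `D(x₁)=D(x₂)={0,1}` and `D(x)={0,1,…,k}`. -/
def I18 (k : ℕ) : BinaryCSP (Fin 3) ℕ where
  dom := fun i => if i = 2 then Finset.range (k + 1) else {0, 1}
  cpt := cpt18
  symm := by
    intro v a w b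
    fin_cases v <;> fin_cases w <;> rfl

theorem mem_dom_I18_of_ne {k : ℕ} {i : Fin 3} (hi : i ≠ 2) {a : ℕ} :
    a ∈ (I18 k).dom i ↔ a = 0 ∨ a = 1 := by
  simp [I18, hi]

theorem zero_mem_dom_I18 (k : ℕ) (i : Fin 3) : 0 ∈ (I18 k).dom i := by
  by_cases hi : i = 2 <;> simp [I18, hi]

theorem one_mem_dom_I18 {k : ℕ} (hk : 1 ≤ k) (i : Fin 3) : 1 ∈ (I18 k).dom i := by
  by_cases hi : i = 2
  · simp [I18, hi]
    omega
  · simp [I18, hi]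

theorem cpt18_zero (i j : Fin 3) : cpt18 i 0 j 0 = true := by
  fin_cases i <;> fin_cases j <;> rfl

theorem cpt18_two_zero (i : Fin 3) (a : ℕ) : cpt18 i a 2 0 = true := by
  fin_cases i <;> simp [cpt18]

theorem arcConsistent_I18 {k : ℕ} (hk : 1 ≤ k) : (I18 k).ArcConsistent := by
  intro v a _ w hw
  have key : cpt18 v a w 0 = true ∨ cpt18 v a w 1 = true := by
    fin_cases v <;> fin_cases w <;> simp [cpt18] at hw ⊢
  rcases key with h | h
  · exact ⟨0, zero_mem_dom_I18 k w, h⟩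
  · exact ⟨1, one_mem_dom_I18 hk w, h⟩

theorem sol_I18_zero (k : ℕ) : (I18 k).Sol (fun _ => 0) :=
  ⟨fun v _ => zero_mem_dom_I18 k v, fun v _ w _ _ => cpt18_zero v w⟩

theorem apply_two_eq_zero_of_sol_I18 {k : ℕ} {s : Fin 3 → ℕ} (hs : (I18 k).Sol s) :
    s 2 = 0 := by
  obtain ⟨hdom, hcpt⟩ := hs
  have h0 := (mem_dom_I18_of_ne (by decide)).1 (hdom 0 trivial)
  have h1 := (mem_dom_I18_of_ne (by decide)).1 (hdom 1 trivial)
  have h01 := hcpt 0 trivial 1 trivial (by decide)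
  have h02 := hcpt 0 trivial 2 trivial (by decide)
  have h12 := hcpt 1 trivial 2 trivial (by decide)
  simp [I18, cpt18] at h01 h02 h12
  omega

/-- for every `k ≥ 1`, the instance `I18 k` is arc-consistent, the
assignment `⟨x,0⟩` is compatible with every assignment to `x₁` and `x₂`, the
all-zero map is a solution, but there is no solution avoiding the value `0` at `x`
(i.e. deleting `0` from `D(x)` yields an unsatisfiable instance).  Consequently,
the pattern I(−), whose distinguished value belongs to an incompatibility edge, is
not a val-elim pattern. -/
theorem iMinus_not_val_elim :
    (∀ k : ℕ, 1 ≤ k →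
      (I18 k).ArcConsistent ∧
      (∀ (i : Fin 3) (a : ℕ), i ≠ 2 → a ∈ (I18 k).dom i → (I18 k).cpt i a 2 0 = true) ∧
      (I18 k).Sol (fun _ => 0) ∧
      (¬ ∃ s, (I18 k).Sol s ∧ s 2 ≠ 0)) ∧
    ¬ (∀ (V D : Type), ∀ _ : Fintype V, ∀ I : BinaryCSP V D,
        (∀ v, (I.dom v).Nonempty) → I.ArcConsistent →
        ∀ (x : V) (b : D), b ∈ I.dom x →
        (¬ ∃ (y : V) (p : D), y ≠ x ∧ p ∈ I.dom y ∧ I.cpt y p x b = false) →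
        ((∃ s, I.Sol s ∧ s x ≠ b) ↔ (∃ s, I.Sol s))) := by
  refine ⟨fun k hk => ⟨arcConsistent_I18 hk, fun i a _ _ => cpt18_two_zero i a, sol_I18_zero k,
    fun ⟨_, hs, h2⟩ => h2 (apply_two_eq_zero_of_sol_I18 hs)⟩, fun h => ?_⟩
  have no_conflict :
      ¬ ∃ (y : Fin 3) (p : ℕ), y ≠ 2 ∧ p ∈ (I18 1).dom y ∧ (I18 1).cpt y p 2 0 = false := by
    rintro ⟨y, p, _, _, hc⟩
    exact Bool.false_ne_true (hc.symm.trans (cpt18_two_zero y p))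
  obtain ⟨_, hs, h2⟩ := (h (Fin 3) ℕ inferInstance (I18 1) (fun v => ⟨0, zero_mem_dom_I18 1 v⟩)
    (arcConsistent_I18 le_rfl) 2 0 (zero_mem_dom_I18 1 2) no_conflict).2 ⟨_, sol_I18_zero 1⟩
  exact h2 (apply_two_eq_zero_of_sol_I18 hs)
end

section
/- Let J be any binary CSP instance with variable set X, domains D(y) (assume 0 ∉ D(y) for every y ∈ X), and compatibility function cpt. Define the binary CSP instance I_J on variables X ∪ {x} (x ∉ X) as follows: D′(y) = D(y) ∪ {0} for y ∈ X, D′(x) = {0,1}; for y,z ∈ X with y ≠ z and a ∈ D(y), b ∈ D(z), cpt′(⟨y,a⟩,⟨z,b⟩) = cpt(⟨y,a⟩,⟨z,b⟩), while ⟨y,0⟩ is compatible with every assignment to every other variable of X; ⟨x,0⟩ is compatible with ⟨y,c⟩ if and only if c = 0; and ⟨x,1⟩ is compatible with ⟨y,c⟩ if and only if c ≠ 0. Then: (i) I_J is arc-consistent; (ii) neither the ∃2snake condition nor the ∃2invsubBTP condition occurs at x with (a,b) = (0,1), i.e., there do not exist distinct variables z, y ∈ X, values s₀, t₀ ∈ D′(z),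 u ∈ D′(y) with cpt′(⟨z,s₀⟩,⟨x,0⟩)=FALSE, cpt′(⟨z,t₀⟩,⟨x,0⟩)=TRUE, cpt′(⟨z,s₀⟩,⟨x,1⟩)=TRUE, and either (cpt′(⟨z,s₀⟩,⟨y,u⟩)=TRUE and cpt′(⟨z,t₀⟩,⟨y,u⟩)=FALSE) or (cpt′(⟨y,u⟩,⟨x,0⟩)=TRUE and cpt′(⟨z,t₀⟩,⟨y,u⟩)=FALSE); (iii) I_J has exactly one solution assigning 0 to x, namely the all-zero assignment; and (iv) I_J has a solution assigning 1 to x if and only if J is satisfiable. -/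
/-- Compatibility of a value of the extra variable `x` (first argument) with a value
of a variable of `X` (second argument): `⟨x,0⟩` is compatible exactly with `0`, and
`⟨x,1⟩` exactly with the values distinct from `0`.  Values `0` and `1` of `x` are
encoded as `Sum.inl 0` and `Sum.inl 1`; original values of `J` as `Sum.inr`. -/
def cptX {D : Type} [DecidableEq D] (a c : ℕ ⊕ D) : Bool :=
  match a with
  | Sum.inl 0 => decide (c = Sum.inl 0)
  | Sum.inl (_ + 1) => !decide (c = Sum.inl 0)
  | Sum.inr _ => true

/-- Compatibility between two variables of `X` in the instance `I_J`: the new value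
`0` is compatible with everything, and original values are compatible according to
the compatibility function of `J`. -/
def cptW {V D : Type} [DecidableEq V] (J : BinaryCSP V D)
    (y : V) (a : ℕ ⊕ D) (z : V) (b : ℕ ⊕ D) : Bool :=
  match a, b with
  | Sum.inr a', Sum.inr b' => decide (y = z) || J.cpt y a' z b'
  | _, _ => true

/-- The instance `I_J` built from an arbitrary binary CSP instance `J`: one extra
variable `x` (encoded `none`) with domain `{0,1}`, domains of `J` extended by the
fresh value `0`. -/
def IJ {V D : Type} [DecidableEq V] [DecidableEq D] (J : BinaryCSP V D) :
    BinaryCSP (Option V) (ℕ ⊕ D) where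
  dom := fun v => match v with
    | none => {Sum.inl 0, Sum.inl 1}
    | some y => insert (Sum.inl 0) ((J.dom y).image Sum.inr)
  cpt := fun v a w b => match v, w with
    | none, none => true
    | none, some _ => cptX a b
    | some _, none => cptX b a
    | some y, some z => cptW J y a z b
  symm := by
    intro v a w b
    cases v <;> cases w <;> try rfl
    show cptW J _ a _ b = cptW J _ b _ a
    cases a <;> cases b <;> try rfl
    show (decide _ || J.cpt _ _ _ _) = (decide _ || J.cpt _ _ _ _)
    rw [J.symm, decide_eq_decide.mpr eq_comm]

section IJ

variable {V D : Type} [DecidableEq V] [DecidableEq D] (J : BinaryCSP V D)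

theorem IJ_mem_dom_none {a : ℕ ⊕ D} :
    a ∈ (IJ J).dom none ↔ a = Sum.inl 0 ∨ a = Sum.inl 1 := by
  simp [IJ]

theorem IJ_mem_dom_some {y : V} {a : ℕ ⊕ D} :
    a ∈ (IJ J).dom (some y) ↔ a = Sum.inl 0 ∨ ∃ d ∈ J.dom y, Sum.inr d = a := by
  simp [IJ]

theorem IJ_cpt_some_none_zero {y : V} {c : ℕ ⊕ D} :
    (IJ J).cpt (some y) c none (Sum.inl 0) = true ↔ c = Sum.inl 0 := by
  simp [IJ, cptX]

theorem IJ_cpt_some_none_one {y : V} {c : ℕ ⊕ D} :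
    (IJ J).cpt (some y) c none (Sum.inl 1) = true ↔ c ≠ Sum.inl 0 := by
  simp [IJ, cptX]

theorem IJ_cpt_inl_left (y z : V) (n : ℕ) (b : ℕ ⊕ D) :
    (IJ J).cpt (some y) (Sum.inl n) (some z) b = true := by
  simp [IJ, cptW]

theorem IJ_cpt_inr_inr {y z : V} (hyz : y ≠ z) (a b : D) :
    (IJ J).cpt (some y) (Sum.inr a) (some z) (Sum.inr b) = J.cpt y a z b := by
  simp [IJ, cptW, hyz]

theorem IJ_arcConsistent (hne : ∀ v, (J.dom v).Nonempty) : (IJ J).ArcConsistent := by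
  intro v a ha w hw
  cases v with
  | none =>
    cases w with
    | none => exact absurd rfl hw
    | some z =>
      rcases (IJ_mem_dom_none J).1 ha with rfl | rfl
      · refine ⟨Sum.inl 0, (IJ_mem_dom_some J).2 (Or.inl rfl), ?_⟩
        rw [(IJ J).symm, IJ_cpt_some_none_zero]
      · obtain ⟨d, hd⟩ := hne z
        refine ⟨Sum.inr d, (IJ_mem_dom_some J).2 (Or.inr ⟨d, hd, rfl⟩), ?_⟩
        rw [(IJ J).symm, IJ_cpt_some_none_one]
        exact Sum.inr_ne_inl
  | some y =>
    cases w with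
    | none =>
      by_cases h : a = Sum.inl 0
      · exact ⟨Sum.inl 0, (IJ_mem_dom_none J).2 (Or.inl rfl), (IJ_cpt_some_none_zero J).2 h⟩
      · exact ⟨Sum.inl 1, (IJ_mem_dom_none J).2 (Or.inr rfl), (IJ_cpt_some_none_one J).2 h⟩
    | some z =>
      refine ⟨Sum.inl 0, (IJ_mem_dom_some J).2 (Or.inl rfl), ?_⟩
      rw [(IJ J).symm, IJ_cpt_inl_left]

theorem IJ_sol_zero : (IJ J).Sol (fun _ => Sum.inl 0) := by
  refine ⟨fun v _ => ?_, fun v _ w _ hvw => ?_⟩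
  · cases v with
    | none => exact (IJ_mem_dom_none J).2 (Or.inl rfl)
    | some y => exact (IJ_mem_dom_some J).2 (Or.inl rfl)
  · cases v with
    | none =>
      cases w with
      | none => exact absurd rfl hvw
      | some z => rw [(IJ J).symm, IJ_cpt_some_none_zero]
    | some y =>
      cases w with
      | none => rw [IJ_cpt_some_none_zero]
      | some z => exact IJ_cpt_inl_left J y z 0 _

theorem IJ_sol_eq_zero {s : Option V → ℕ ⊕ D} (hs : (IJ J).Sol s)
    (h0 : s none = Sum.inl 0) (v : Option V) : s v = Sum.inl 0 := by
  cases v with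
  | none => exact h0
  | some y =>
    have h := hs.2 (some y) trivial none trivial (Option.some_ne_none y)
    rwa [h0, IJ_cpt_some_none_zero] at h

theorem IJ_exists_sol_one_iff :
    (∃ s, (IJ J).Sol s ∧ s none = Sum.inl 1) ↔ ∃ t, J.Sol t := by
  constructor
  · rintro ⟨s, hs, h1⟩
    have hval : ∀ y, ∃ d ∈ J.dom y, Sum.inr d = s (some y) := by
      intro y
      have h := hs.2 (some y) trivial none trivial (Option.some_ne_none y)
      rw [h1, IJ_cpt_some_none_one] at h
      exact ((IJ_mem_dom_some J).1 (hs.1 (some y) trivial)).resolve_left h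
    choose t ht hts using hval
    refine ⟨t, fun y _ => ht y, fun y _ z _ hyz => ?_⟩
    have h := hs.2 (some y) trivial (some z) trivial (fun e => hyz (Option.some.inj e))
    rwa [← hts, ← hts, IJ_cpt_inr_inr J hyz] at h
  · rintro ⟨t, ht⟩
    refine ⟨fun v => v.elim (Sum.inl 1) (fun y => Sum.inr (t y)),
      ⟨fun v _ => ?_, fun v _ w _ hvw => ?_⟩, rfl⟩
    · cases v with
      | none => exact (IJ_mem_dom_none J).2 (Or.inr rfl)
      | some y => exact (IJ_mem_dom_some J).2 (Or.inr ⟨t y, ht.1 y trivial, rfl⟩)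
    · cases v with
      | none =>
        cases w with
        | none => exact absurd rfl hvw
        | some z =>
          rw [(IJ J).symm]
          exact (IJ_cpt_some_none_one J).2 Sum.inr_ne_inl
      | some y =>
        cases w with
        | none => exact (IJ_cpt_some_none_one J).2 Sum.inr_ne_inl
        | some z =>
          have hyz : y ≠ z := fun e => hvw (congrArg some e)
          exact (IJ_cpt_inr_inr J hyz _ _).trans (ht.2 y trivial z trivial hyz)

end IJ

/-- the instance `I_J` is arc-consistent; neither the ∃2snake
condition nor the ∃2invsubBTP condition occurs at `x` with `(a,b) = (0,1)`; `I_J`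
has exactly one solution assigning `0` to `x`, namely the all-zero assignment; and
`I_J` has a solution assigning `1` to `x` iff `J` is satisfiable. -/
theorem IJ_properties {V D : Type} [Fintype V] [DecidableEq V] [DecidableEq D]
    (J : BinaryCSP V D) (hne : ∀ v, (J.dom v).Nonempty) :
    (IJ J).ArcConsistent ∧
    (¬ ∃ (z y : Option V) (s₀ t₀ u : ℕ ⊕ D),
      z ≠ none ∧ y ≠ none ∧ z ≠ y ∧
      s₀ ∈ (IJ J).dom z ∧ t₀ ∈ (IJ J).dom z ∧ u ∈ (IJ J).dom y ∧
      (IJ J).cpt z s₀ none (Sum.inl 0) = false ∧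
      (IJ J).cpt z t₀ none (Sum.inl 0) = true ∧
      (IJ J).cpt z s₀ none (Sum.inl 1) = true ∧
      (((IJ J).cpt z s₀ y u = true ∧ (IJ J).cpt z t₀ y u = false) ∨
       ((IJ J).cpt y u none (Sum.inl 0) = true ∧ (IJ J).cpt z t₀ y u = false))) ∧
    ((IJ J).Sol (fun _ => Sum.inl 0) ∧
      ∀ s, (IJ J).Sol s → s none = Sum.inl 0 → ∀ v, s v = Sum.inl 0) ∧
    ((∃ s, (IJ J).Sol s ∧ s none = Sum.inl 1) ↔ (∃ t, J.Sol t)) := by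
  refine ⟨IJ_arcConsistent J hne, ?_, ⟨IJ_sol_zero J, fun s => IJ_sol_eq_zero J⟩,
    IJ_exists_sol_one_iff J⟩
  rintro ⟨z, y, s₀, t₀, u, hz, hy, -, -, -, -, -, ht, -, h⟩
  obtain ⟨z, rfl⟩ := Option.ne_none_iff_exists'.1 hz
  obtain ⟨y, rfl⟩ := Option.ne_none_iff_exists'.1 hy
  obtain rfl := (IJ_cpt_some_none_zero J).1 ht
  simp [IJ_cpt_inl_left] at h
end
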